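/- For each graph G in {Z_eighth, Z_strong} and every real c with 0 < c < 1/6, the set q(G, t ↦ ⌈c·t^{1/2}⌉) strictly contains q(G, ∞). That is, against the spreading function g(t) = ⌈c·√t⌉ Container can win for some strength q for which Container loses the Firefighter Problem solitaire (unrestricted spreading). -/

import Mathlib

open Set

/-- The number of vertices Container of strength `q` may delete at turn `t`:
`⌊t·q⌋ − ⌊(t−1)·q⌋`. -/
noncomputable def budget (q : ℝ) (t : ℕ) : ℕ :=
  (⌊(t : ℝ) * q⌋ - ⌊((t : ℝ) - 1) * q⌋).toNat

/-- The cumulative deleted sets determined by a Container strategy `σ`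
(mapping the history `[B 0, …, B t]` of occupied sets to the set of vertices deleted
at turn `t + 1`) against the occupied sets `B`. -/
def delSets {V : Type*} (σ : List (Set V) → Set V) (B : ℕ → Set V) : ℕ → Set V
  | 0 => ∅
  | t + 1 => delSets σ B t ∪ σ ((List.range (t + 1)).map B)

/-- Spreader's moves are legal with spread function `g` against cumulative deleted
sets `F`: occupied sets increase, at most `g (t + 1)` vertices are newly occupied at
turn `t + 1`, and each newly occupied vertex is undeleted and adjacent (with respect
to `adj`) to a previously occupied vertex. -/
def SpreaderLegal {V : Type*} (adj : V → V → Prop) (g : ℕ → ℕ∞)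
    (F B : ℕ → Set V) : Prop :=
  ∀ t : ℕ,
    B t ⊆ B (t + 1) ∧
    (B (t + 1) \ B t).encard ≤ g (t + 1) ∧
    ∀ v ∈ B (t + 1) \ B t, v ∉ F (t + 1) ∧ ∃ u ∈ B t, adj u v

/-- The Container strategy `σ` plays legally along occupied sets `B`: at every turn it
deletes only unoccupied vertices, and at most the budget of them. -/
def ContainerLegal {V : Type*} (q : ℝ) (σ : List (Set V) → Set V)
    (B : ℕ → Set V) : Prop :=
  ∀ t : ℕ,
    σ ((List.range (t + 1)).map B) ∩ B t = ∅ ∧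
    (σ ((List.range (t + 1)).map B)).encard ≤ (budget q (t + 1) : ℕ∞)

/-- Container of strength `q` wins the containment game on the graph `adj` with spread
function `g` and initial occupied set `B₀`, deleting only vertices of `A`: it has a
strategy which, against every legal Spreader play, is itself legal, deletes only
vertices of `A`, and forces the occupied set to eventually stabilize. -/
def ContainerWinsIn {V : Type*} (adj : V → V → Prop) (q : ℝ) (g : ℕ → ℕ∞)
    (B₀ : Set V) (A : Set V) : Prop :=
  ∃ σ : List (Set V) → Set V,
    ∀ B : ℕ → Set V, B 0 = B₀ → SpreaderLegal adj g (delSets σ B) B →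
      ContainerLegal q σ B ∧
      (∀ t : ℕ, σ ((List.range (t + 1)).map B) ⊆ A) ∧
      ∃ T : ℕ, ∀ t : ℕ, T ≤ t → B t = B T

/-- Container of strength `q` wins the containment game `(adj, q, g)` with initial
occupied set `B₀`. -/
def ContainerWins {V : Type*} (adj : V → V → Prop) (q : ℝ) (g : ℕ → ℕ∞)
    (B₀ : Set V) : Prop :=
  ContainerWinsIn adj q g B₀ Set.univ

/-- `q(G, g)`: the set of strengths `q > 0` for which Container wins the containment
game `(adj, q, g)` from every finite initial occupied set. -/
def qSet {V : Type*} (adj : V → V → Prop) (g : ℕ → ℕ∞) : Set ℝ :=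
  {q | 0 < q ∧ ∀ B₀ : Set V, B₀.Finite → ContainerWins adj q g B₀}

/-- The occupied sets determined by a Spreader strategy `τ` (mapping the history
`[F 1, …, F (t + 1)]` of cumulative deleted sets to the set of vertices newly occupied
at turn `t + 1`) against deleted sets `F`, starting from `B₀`. -/
def occSets {V : Type*} (τ : List (Set V) → Set V) (B₀ : Set V)
    (F : ℕ → Set V) : ℕ → Set V
  | 0 => B₀
  | t + 1 => occSets τ B₀ F t ∪ τ ((List.range (t + 1)).map fun i => F (i + 1))

/-- The sequence `F` of cumulative deleted sets is a legal play of Container of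
strength `q` against occupied sets `B`. -/
def ContainerSeqLegal {V : Type*} (q : ℝ) (F B : ℕ → Set V) : Prop :=
  F 0 = ∅ ∧ ∀ t : ℕ,
    F t ⊆ F (t + 1) ∧
    (F (t + 1) \ F t).encard ≤ (budget q (t + 1) : ℕ∞) ∧
    (F (t + 1) \ F t) ∩ B t = ∅

/-- Spreader wins the containment game `(adj, q, g)` with initial occupied set `B₀`:
it has a strategy which, against every legal Container play, is itself legal and
occupies new vertices at arbitrarily late times. -/
def SpreaderWins {V : Type*} (adj : V → V → Prop) (q : ℝ) (g : ℕ → ℕ∞)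
    (B₀ : Set V) : Prop :=
  ∃ τ : List (Set V) → Set V,
    ∀ F : ℕ → Set V, ContainerSeqLegal q F (occSets τ B₀ F) →
      SpreaderLegal adj g F (occSets τ B₀ F) ∧
      ∀ T : ℕ, ∃ t : ℕ, T ≤ t ∧ occSets τ B₀ F t ≠ occSets τ B₀ F T

/-- The strongly connected grid `ℤ ⊠ ℤ`. -/
def adjStrong (p q : ℤ × ℤ) : Prop :=
  max |p.1 - q.1| |p.2 - q.2| = 1

/-- The vertices of the eighth plane: `{(x, y) ∈ ℤ² : 0 ≤ x ≤ y}`. -/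
abbrev ZEighth : Type := {p : ℤ × ℤ // 0 ≤ p.1 ∧ p.1 ≤ p.2}

/-- The edges of the eighth plane: `(x, y) ~ (x + i, y + 1)` for `i ∈ {0, 1}`. -/
def adjEighth (p q : ZEighth) : Prop :=
  (q.val.2 = p.val.2 + 1 ∧ (q.val.1 = p.val.1 ∨ q.val.1 = p.val.1 + 1)) ∨
  (p.val.2 = q.val.2 + 1 ∧ (p.val.1 = q.val.1 ∨ p.val.1 = q.val.1 + 1))


section generic
variable {V : Type*}

lemma mem_delSets {σ : List (Set V) → Set V} {B : ℕ → Set V} {t : ℕ} {v : V} :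
    v ∈ delSets σ B t ↔ ∃ i, i < t ∧ v ∈ σ ((List.range (i + 1)).map B) := by
  induction t with
  | zero => simp [delSets]
  | succ t ih =>
    rw [delSets, Set.mem_union, ih]
    constructor
    · rintro (⟨i, hi, h⟩ | h)
      · exact ⟨i, by omega, h⟩
      · exact ⟨t, by omega, h⟩
    · rintro ⟨i, hi, h⟩
      rcases Nat.lt_succ_iff_lt_or_eq.mp hi with h' | h'
      · exact Or.inl ⟨i, h', h⟩
      · subst h'; exact Or.inr h

def fsP (adj : V → V → Prop) (σ : List (Set V) → Set V) (B₀ : Set V) :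
    ℕ → List (Set V) × Set V × Set V
  | 0 => ([B₀], ∅, B₀)
  | t + 1 =>
    let p := fsP adj σ B₀ t
    let F := p.2.1 ∪ σ p.1
    let B := p.2.2 ∪ {v | v ∉ F ∧ ∃ u ∈ p.2.2, adj u v}
    (p.1 ++ [B], F, B)

lemma exists_full (adj : V → V → Prop) (σ : List (Set V) → Set V) (B₀ : Set V) :
    ∃ B : ℕ → Set V, B 0 = B₀ ∧ ∀ t, B (t + 1) =
      B t ∪ {v | v ∉ delSets σ B (t + 1) ∧ ∃ u ∈ B t, adj u v} := by
  let B : ℕ → Set V := fun t => (fsP adj σ B₀ t).2.2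
  have h1 : ∀ t, (fsP adj σ B₀ t).1 = (List.range (t + 1)).map B := by
    intro t
    induction t with
    | zero => simp [fsP, B]
    | succ t ih =>
      rw [List.range_succ, List.map_append, ← ih]
      simp [fsP, B]
  have h2 : ∀ t, (fsP adj σ B₀ t).2.1 = delSets σ B t := by
    intro t
    induction t with
    | zero => simp [fsP, delSets]
    | succ t ih =>
      rw [delSets, ← h1, ← ih]
      simp [fsP]
  refine ⟨B, rfl, fun t => ?_⟩
  rw [← h2]
  rfl

/-- What a Container win against unrestricted spreading yields. -/
lemma wins_full {adj : V → V → Prop} {q : ℝ} {k : ℕ} (hk : ∀ t, budget q (t + 1) = k)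
    {B₀ : Set V} (h : ContainerWins adj q (fun _ => ⊤) B₀) :
    ∃ (B : ℕ → Set V) (F : ℕ → Finset V), B 0 = B₀ ∧
      (∀ t, F t ⊆ F (t + 1)) ∧ (∀ t, (F t).card ≤ k * t) ∧
      (∀ t, B (t + 1) = B t ∪ {v | v ∉ F (t + 1) ∧ ∃ u ∈ B t, adj u v}) ∧
      ∃ T, ∀ t, T ≤ t → B t = B T := by
  obtain ⟨σ, hσ⟩ := h
  obtain ⟨B, hB0, hB⟩ := exists_full adj σ B₀
  have hleg : SpreaderLegal adj (fun _ => ⊤) (delSets σ B) B := by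
    intro t
    refine ⟨?_, le_top, ?_⟩
    · rw [hB t]; exact Set.subset_union_left
    · rintro v ⟨hv, hv'⟩
      rw [hB t] at hv
      rcases hv with hv | hv
      · exact absurd hv hv'
      · exact hv
  obtain ⟨hcl, -, hT⟩ := hσ B hB0 hleg
  have hfin : ∀ t, (delSets σ B t).encard ≤ ((k * t : ℕ) : ℕ∞) := by
    intro t
    induction t with
    | zero => simp [delSets]
    | succ t ih =>
      rw [delSets]
      refine (Set.encard_union_le _ _).trans ?_
      have := (hcl t).2
      rw [hk] at this
      calc _ ≤ ((k * t : ℕ) : ℕ∞) + (k : ℕ∞) := add_le_add ih this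
        _ = ((k * (t + 1) : ℕ) : ℕ∞) := by push_cast; ring
  have hf : ∀ t, (delSets σ B t).Finite := fun t =>
    Set.finite_of_encard_le_coe (hfin t)
  refine ⟨B, fun t => (hf t).toFinset, hB0, ?_, ?_, ?_, hT⟩
  · intro t v hv
    rw [Set.Finite.mem_toFinset] at hv ⊢
    exact Set.subset_union_left hv
  · intro t
    have := hfin t
    rw [(hf t).encard_eq_coe_toFinset_card] at this
    exact_mod_cast this
  · intro t
    simp only [Set.Finite.mem_toFinset]
    exact hB t

/-! ### The Container side -/

open Classical in
/-- an element of `R` closest to `S` -/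
noncomputable def choiceC (d : V → V → ℕ) (S : Set V) (R : Finset V) : Finset V :=
  if h : R.Nonempty then
    {(Finset.exists_min_image R (fun v => sInf (d v '' S)) h).choose} else ∅

lemma choiceC_subset (d : V → V → ℕ) (S : Set V) (R : Finset V) : choiceC d S R ⊆ R := by
  unfold choiceC
  split_ifs with h
  · simpa using (Finset.exists_min_image R (fun v => sInf (d v '' S)) h).choose_spec.1
  · simp

lemma choiceC_card (d : V → V → ℕ) (S : Set V) (R : Finset V) :
    (choiceC d S R).card = if R.card = 0 then 0 else 1 := by
  unfold choiceC
  split_ifs with h h' h'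
  · rw [Finset.card_eq_zero] at h'; simp [h'] at h
  · simp
  · simp
  · rw [Finset.not_nonempty_iff_eq_empty] at h; simp [h] at h'

lemma choiceC_spec (d : V → V → ℕ) (S : Set V) (R : Finset V) (u : V) (hu : u ∈ R)
    (x : V) (hx : x ∈ S) :
    ∃ v ∈ choiceC d S R, ∃ y ∈ S, d v y ≤ d u x := by
  have h : R.Nonempty := ⟨u, hu⟩
  have hs := (Finset.exists_min_image R (fun v => sInf (d v '' S)) h).choose_spec
  set v := (Finset.exists_min_image R (fun v => sInf (d v '' S)) h).choose with hv
  refine ⟨v, ?_, ?_⟩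
  · unfold choiceC
    rw [dif_pos h]
    simp [hv]
  · have h1 := hs.2 u hu
    have h2 : sInf (d v '' S) ∈ d v '' S := Nat.sInf_mem ⟨_, x, hx, rfl⟩
    obtain ⟨y, hy, hy'⟩ := h2
    refine ⟨y, hy, ?_⟩
    have h3 : sInf (d u '' S) ≤ d u x := Nat.sInf_le ⟨x, hx, rfl⟩
    have h1' : sInf (d v '' S) ≤ sInf (d u '' S) := h1
    omega

open Classical in
noncomputable def remC (d : V → V → ℕ) (U : Finset V) (s : ℕ) (B : ℕ → Set V) : ℕ → Finset V
  | 0 => U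
  | i + 1 => remC d U s B i \ choiceC d (B (s + i)) (remC d U s B i)

noncomputable def pickC (d : V → V → ℕ) (U : Finset V) (s : ℕ) (B : ℕ → Set V) (t : ℕ) :
    Finset V :=
  if s ≤ t then choiceC d (B t) (remC d U s B (t - s)) else ∅

lemma remC_congr (d : V → V → ℕ) (U : Finset V) (s : ℕ) (B B' : ℕ → Set V) (i : ℕ)
    (h : ∀ j, j < s + i → B j = B' j) : remC d U s B i = remC d U s B' i := by
  induction i with
  | zero => rfl
  | succ i ih =>
    simp only [remC]
    rw [ih (fun j hj => h j (by omega)), h (s + i) (by omega)]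

lemma pickC_congr (d : V → V → ℕ) (U : Finset V) (s : ℕ) (B B' : ℕ → Set V) (t : ℕ)
    (h : ∀ j, j ≤ t → B j = B' j) : pickC d U s B t = pickC d U s B' t := by
  unfold pickC
  split_ifs with hs
  · rw [remC_congr d U s B B' (t - s) (fun j hj => h j (by omega)), h t le_rfl]
  · rfl

lemma remC_card (d : V → V → ℕ) (U : Finset V) (s : ℕ) (B : ℕ → Set V) (i : ℕ) :
    (remC d U s B i).card = U.card - i := by
  induction i with
  | zero => rfl
  | succ i ih =>
    classical
    simp only [remC]
    rw [Finset.card_sdiff_of_subset (choiceC_subset _ _ _), choiceC_card, ih]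
    split_ifs <;> omega

lemma remC_anti (d : V → V → ℕ) (U : Finset V) (s : ℕ) (B : ℕ → Set V) (i j : ℕ) (h : i ≤ j) :
    remC d U s B j ⊆ remC d U s B i := by
  induction j, h using Nat.le_induction with
  | base => rfl
  | succ j _ ih => classical exact (Finset.sdiff_subset).trans ih

lemma pickC_subset (d : V → V → ℕ) (U : Finset V) (s : ℕ) (B : ℕ → Set V) (t : ℕ) :
    pickC d U s B t ⊆ U := by
  unfold pickC
  split_ifs
  · exact (choiceC_subset _ _ _).trans (remC_anti d U s B 0 _ (Nat.zero_le _))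
  · simp

lemma pickC_card (d : V → V → ℕ) (U : Finset V) (s : ℕ) (B : ℕ → Set V) (t : ℕ) :
    (pickC d U s B t).card = if s ≤ t ∧ t < s + U.card then 1 else 0 := by
  unfold pickC
  split_ifs with h1 h2 h2
  · rw [choiceC_card, remC_card, if_neg (by omega)]
  · rw [choiceC_card, remC_card, if_pos (by omega)]
  · omega
  · simp

end generic

section window
variable {V : Type*}

lemma remC_of_not_pick (d : V → V → ℕ) (U : Finset V) (s : ℕ) (B : ℕ → Set V) (u : V)
    (hu : u ∈ U) (m : ℕ) (h : ∀ i, i < m → u ∉ pickC d U s B (s + i)) :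
    u ∈ remC d U s B m := by
  classical
  induction m with
  | zero => exact hu
  | succ m ih =>
    have h1 := ih (fun i hi => h i (by omega))
    have h2 := h m (by omega)
    unfold pickC at h2
    rw [if_pos (by omega), Nat.add_sub_cancel_left] at h2
    simp only [remC]
    exact Finset.mem_sdiff.mpr ⟨h1, h2⟩

lemma pick_not_rem (d : V → V → ℕ) (U : Finset V) (s : ℕ) (B : ℕ → Set V) (v : V)
    (i j : ℕ) (hij : i < j) (h : v ∈ pickC d U s B (s + i)) : v ∉ remC d U s B j := by
  classical
  intro hj
  have h1 := remC_anti d U s B (i + 1) j hij hj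
  unfold pickC at h
  rw [if_pos (by omega), Nat.add_sub_cancel_left] at h
  simp only [remC] at h1
  exact (Finset.mem_sdiff.mp h1).2 h

lemma pick_mem_rem (d : V → V → ℕ) (U : Finset V) (s : ℕ) (B : ℕ → Set V) (v : V)
    (i : ℕ) (h : v ∈ pickC d U s B (s + i)) : v ∈ remC d U s B i := by
  unfold pickC at h
  rw [if_pos (by omega), Nat.add_sub_cancel_left] at h
  exact choiceC_subset _ _ _ h

lemma window {adj : V → V → Prop} {d : V → V → ℕ} (hd0 : ∀ u, d u u = 0)
    (hd1 : ∀ u x y, adj x y → d u x ≤ d u y + 1)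
    {B : ℕ → Set V} {U : Finset V} {s H M : ℕ}
    (hmono : ∀ t, B t ⊆ B (t + 1))
    (hnew : ∀ t v, v ∈ B (t + 1) → v ∉ B t → ∃ x ∈ B t, adj x v)
    (hcard : ∀ t, t < s + U.card → (B (t + 1) \ B t).encard ≤ (M : ℕ∞))
    (hpick : ∀ i t v, v ∈ pickC d U s B i → i ≤ t → v ∈ B (t + 1) → v ∈ B t)
    (hdist : ∀ u ∈ U, ∀ b ∈ B 0, s + H ≤ d u b)
    (hdisj : ∀ u ∈ U, ∀ u' ∈ U, ∀ v, d u v < H → d u' v < H → u = u')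
    (hsum : U.card * M < ∑ j ∈ Finset.range H, (j + 1)) :
    ∀ t, ∀ u ∈ U, u ∉ B t := by
  classical
  have hm : Monotone B := monotone_nat_of_le_succ hmono
  have h1 : ∀ τ, ∀ x ∈ B τ, ∀ u ∈ U, s + H ≤ d u x + τ := by
    intro τ
    induction τ with
    | zero => intro x hx u hu; simpa using hdist u hu x hx
    | succ τ ih =>
      intro x hx u hu
      by_cases hx' : x ∈ B τ
      · have := ih x hx' u hu; omega
      · obtain ⟨y, hy, hyx⟩ := hnew τ x hx hx'
        have := ih y hy u hu
        have := hd1 u y x hyx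
        omega
  by_contra hcon
  push Not at hcon
  have hmin := fun (k : ℕ) => Nat.find_min (m := k) hcon
  obtain ⟨u, hu, hut⟩ := Nat.find_spec hcon
  set t := Nat.find hcon with ht
  have ht0 : s + H ≤ t := by have := h1 t u hut u hu; rw [hd0] at this; omega
  have hH : 0 < H := by
    rcases Nat.eq_zero_or_pos H with h | h
    · subst h; simp at hsum
    · exact h
  obtain ⟨m, hmt⟩ : ∃ m, t = s + m := ⟨t - s, by omega⟩
  have h3 : ∀ j, j ≤ t → ∃ x ∈ B (t - j), d u x ≤ j := by
    intro j
    induction j with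
    | zero => intro _; exact ⟨u, hut, by rw [hd0]⟩
    | succ j ih =>
      intro hj
      obtain ⟨x, hx, hxj⟩ := ih (by omega)
      by_cases hx' : x ∈ B (t - (j + 1))
      · exact ⟨x, hx', by omega⟩
      · have e : t - j = t - (j + 1) + 1 := by omega
        rw [e] at hx
        obtain ⟨y, hy, hyx⟩ := hnew _ x hx hx'
        exact ⟨y, hy, by have := hd1 u y x hyx; omega⟩
  have h4 : ∀ i, i < m → u ∉ pickC d U s B (s + i) := by
    intro i hi hp
    have := hpick (s + i) (t - 1) u hp (by omega) (by rw [Nat.sub_add_cancel (by omega)]; exact hut)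
    exact hmin (t - 1) (by omega) ⟨u, hu, this⟩
  have h4' : ∀ i, i ≤ m → u ∈ remC d U s B i := fun i hi =>
    remC_of_not_pick d U s B u hu i (fun j hj => h4 j (by omega))
  have hmU : m < U.card := by
    have h := Finset.card_pos.mpr ⟨u, h4' m le_rfl⟩
    rw [remC_card] at h; omega
  have h5 : ∀ k, ∃ v, k ≤ m → (v ∈ U ∧ (∃ y ∈ B t, d v y ≤ k) ∧
      ((k = 0 ∧ v = u) ∨ (1 ≤ k ∧ v ∈ pickC d U s B (s + (m - k))))) := by
    intro k
    by_cases hk : k ≤ m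
    swap
    · exact ⟨u, fun h => absurd h hk⟩
    rcases Nat.eq_zero_or_pos k with h0 | h0
    · exact ⟨u, fun _ => ⟨hu, ⟨u, hut, by rw [hd0]; omega⟩, Or.inl ⟨h0, rfl⟩⟩⟩
    · obtain ⟨x, hx, hxk⟩ := h3 k (by omega)
      have e : t - k = s + (m - k) := by omega
      rw [e] at hx
      obtain ⟨v, hv, y, hy, hvy⟩ := choiceC_spec d (B (s + (m - k))) (remC d U s B (m - k)) u
        (h4' _ (by omega)) x hx
      have hvp : v ∈ pickC d U s B (s + (m - k)) := by
        unfold pickC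
        rw [if_pos (by omega), Nat.add_sub_cancel_left]; exact hv
      exact ⟨v, fun _ => ⟨pickC_subset _ _ _ _ _ hvp, ⟨y, hm (by omega) hy, by omega⟩,
        Or.inr ⟨h0, hvp⟩⟩⟩
  choose w hw using h5
  have hwlt : ∀ k k', k < k' → k' ≤ m → w k ≠ w k' := by
    intro k k' hkk hk' he
    obtain ⟨-, -, h⟩ := hw k (by omega)
    obtain ⟨-, -, h'⟩ := hw k' hk'
    rcases h' with ⟨h', _⟩ | ⟨h', hp'⟩
    · omega
    · rw [← he] at hp'
      rcases h with ⟨h, hp⟩ | ⟨h, hp⟩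
      · rw [hp] at hp'; exact h4 _ (by omega) hp'
      · exact pick_not_rem d U s B _ (m - k') (m - k) (by omega) hp' (pick_mem_rem _ _ _ _ _ _ hp)
  have hwinj : ∀ k k', k ≤ m → k' ≤ m → w k = w k' → k = k' := by
    intro k k' hk hk' he
    rcases lt_trichotomy k k' with h | h | h
    · exact absurd he (hwlt _ _ h hk')
    · exact h
    · exact absurd he.symm (hwlt _ _ h hk)
  have h6 : ∀ j, j < H → ∀ v ∈ U, ∀ τ, ∀ y ∈ B τ, d v y ≤ j →
      ∃ x, x ∈ B τ ∧ x ∉ B s ∧ d v x = j := by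
    intro j hj v hv τ
    induction τ with
    | zero => intro y hy hyj; have := hdist v hv y hy; omega
    | succ τ ih =>
      intro y hy hyj
      by_cases he : d v y = j
      · refine ⟨y, hy, fun hys => ?_, he⟩
        have := h1 s y hys v hv; omega
      · by_cases hy' : y ∈ B τ
        · obtain ⟨x, hx, h⟩ := ih y hy' hyj
          exact ⟨x, hmono _ hx, h⟩
        · obtain ⟨z, hz, hzy⟩ := hnew τ y hy hy'
          have := hd1 v z y hzy
          obtain ⟨x, hx, h⟩ := ih z hz (by omega)
          exact ⟨x, hmono _ hx, h⟩
  have h7 : ∀ p : ℕ × ℕ, ∃ x, p.1 < H → p.2 ≤ p.1 → (x ∈ B t ∧ x ∉ B s ∧ d (w p.2) x = p.1) := by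
    intro p
    by_cases hp : p.1 < H ∧ p.2 ≤ p.1
    · obtain ⟨hwU, ⟨y, hy, hyk⟩, -⟩ := hw p.2 (by omega)
      obtain ⟨x, hx⟩ := h6 p.1 hp.1 (w p.2) hwU t y hy (by omega)
      exact ⟨x, fun _ _ => hx⟩
    · exact ⟨u, fun h h' => absurd ⟨h, h'⟩ hp⟩
  choose f hf using h7
  have hcnt : ∀ i, i ≤ U.card → (B (s + i) \ B s).encard ≤ ((i * M : ℕ) : ℕ∞) := by
    intro i
    induction i with
    | zero => intro _; simp
    | succ i ih =>
      intro hi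
      have hsub : B (s + (i + 1)) \ B s ⊆ (B (s + i) \ B s) ∪ (B (s + i + 1) \ B (s + i)) := by
        rintro x ⟨hx, hxs⟩
        by_cases hx' : x ∈ B (s + i)
        · exact Or.inl ⟨hx', hxs⟩
        · exact Or.inr ⟨hx, hx'⟩
      refine (Set.encard_le_encard hsub).trans ((Set.encard_union_le _ _).trans ?_)
      refine (add_le_add (ih (by omega)) (hcard (s + i) (by omega))).trans ?_
      rw [← Nat.cast_add]
      exact_mod_cast (by ring_nf; omega : i * M + M ≤ (i + 1) * M)
  let P : Finset (Σ _ : ℕ, ℕ) := (Finset.range H).sigma (fun j => Finset.range (j + 1))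
  have hP : P.card = ∑ j ∈ Finset.range H, (j + 1) := by
    simp [P, Finset.card_sigma]
  have hmem : ∀ p ∈ P, p.1 < H ∧ p.2 ≤ p.1 := by
    intro p hp
    simp only [P, Finset.mem_sigma, Finset.mem_range] at hp
    omega
  let g : (Σ _ : ℕ, ℕ) → V := fun p => f (p.1, p.2)
  have hinj : Set.InjOn g (P : Set (Σ _ : ℕ, ℕ)) := by
    rintro ⟨j, k⟩ hp ⟨j', k'⟩ hp' he
    have a := hmem _ hp
    have a' := hmem _ hp'
    simp only at a a'
    have b := hf (j, k) a.1 a.2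
    have b' := hf (j', k') a'.1 a'.2
    simp only [g] at he
    rw [← he] at b'
    simp only at b b'
    have hk : k = k' := by
      apply hwinj k k' (by omega) (by omega)
      exact hdisj _ (hw k (by omega)).1 _ (hw k' (by omega)).1 _
        (by rw [b.2.2]; exact a.1) (by rw [b'.2.2]; exact a'.1)
    subst hk
    have : j = j' := by rw [← b.2.2, ← b'.2.2]
    subst this; rfl
  have hsubset : ((P.image g : Finset V) : Set V) ⊆ B (s + m) \ B s := by
    intro x hx
    rw [Finset.mem_coe, Finset.mem_image] at hx
    obtain ⟨p, hp, rfl⟩ := hx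
    have a := hmem p hp
    have b := hf (p.1, p.2) a.1 a.2
    rw [← hmt]
    exact ⟨b.1, b.2.1⟩
  have := (Set.encard_le_encard hsubset).trans (hcnt m hmU.le)
  rw [Set.encard_coe_eq_coe_finsetCard, Finset.card_image_of_injOn hinj, hP] at this
  have h8 : ∑ j ∈ Finset.range H, (j + 1) ≤ m * M := by exact_mod_cast this
  have h9 : m * M ≤ U.card * M := Nat.mul_le_mul_right _ hmU.le
  omega

end window

section core
variable {V : Type*}

lemma stabilize {B : ℕ → Set V} (hm : Monotone B) {I : Set V} (hI : I.Finite)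
    (h : ∀ t, B t ⊆ I) : ∃ T, ∀ t, T ≤ t → B t = B T := by
  have hfin : (Set.range fun t => (B t).ncard).Finite := by
    apply (Set.finite_Iic I.ncard).subset
    rintro _ ⟨t, rfl⟩
    exact Set.ncard_le_ncard (h t) hI
  obtain ⟨_, ⟨T, rfl⟩, hT⟩ := Set.exists_max_image _ id hfin ⟨_, 0, rfl⟩
  refine ⟨T, fun t ht => ?_⟩
  symm
  exact Set.eq_of_subset_of_ncard_le (hm ht) (hT _ ⟨t, rfl⟩) (hI.subset (h t))

/-- hypotheses on a window -/
structure WinHyp (d : V → V → ℕ) (g : ℕ → ℕ∞) (B₀ : Set V) (U : Finset V) (s H M : ℕ) : Prop where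
  hdist : ∀ u ∈ U, ∀ b ∈ B₀, s + H ≤ d u b
  hdisj : ∀ u ∈ U, ∀ u' ∈ U, ∀ v, d u v < H → d u' v < H → u = u'
  hsum : U.card * M < ∑ j ∈ Finset.range H, (j + 1)
  hM : ∀ t, t < s + U.card → g (t + 1) ≤ (M : ℕ∞)

lemma WinHyp.empty (d : V → V → ℕ) (g : ℕ → ℕ∞) (B₀ : Set V) : WinHyp d g B₀ ∅ 0 1 0 where
  hdist := by simp
  hdisj := by simp
  hsum := by simp
  hM := by simp

theorem core {adj : V → V → Prop} {d : V → V → ℕ} (hd0 : ∀ u, d u u = 0)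
    (hd1 : ∀ u x y, adj x y → d u x ≤ d u y + 1)
    {q : ℝ} {g : ℕ → ℕ∞} {B₀ : Set V} {k : ℕ} (hq : ∀ t, k ≤ budget q (t + 1))
    (A : ℕ → Finset V) {U1 U2 : Finset V} {s1 H1 M1 s2 H2 M2 : ℕ}
    (w1 : WinHyp d g B₀ U1 s1 H1 M1) (w2 : WinHyp d g B₀ U2 s2 H2 M2)
    (hdA : ∀ t, ∀ v ∈ A t, ∀ b ∈ B₀, t + 1 ≤ d v b)
    (hbud : ∀ t, (A t).card + (if s1 ≤ t ∧ t < s1 + U1.card then 1 else 0)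
      + (if s2 ≤ t ∧ t < s2 + U2.card then 1 else 0) ≤ k)
    {I : Set V} (hI : I.Finite) (hB0 : B₀ ⊆ I)
    (hclose : ∀ x ∈ I, ∀ y, adj x y → y ∈ I ∨ (∃ t, y ∈ A t) ∨ y ∈ U1 ∨ y ∈ U2) :
    ContainerWins adj q g B₀ := by
  classical
  let σ : List (Set V) → Set V := fun l =>
    ((A (l.length - 1) ∪ pickC d U1 s1 (fun i => l.getD i ∅) (l.length - 1)
      ∪ pickC d U2 s2 (fun i => l.getD i ∅) (l.length - 1) : Finset V) : Set V)
  refine ⟨σ, fun B hB hleg => ?_⟩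
  have hσ : ∀ t, σ ((List.range (t + 1)).map B) =
      ((A t ∪ pickC d U1 s1 B t ∪ pickC d U2 s2 B t : Finset V) : Set V) := by
    intro t
    have e : ∀ j, j ≤ t → ((List.range (t + 1)).map B).getD j ∅ = B j := by
      intro j hj
      have hj' : j < t + 1 := by omega
      simp [List.getD, hj']
    simp only [σ, List.length_map, List.length_range, Nat.add_sub_cancel]
    rw [pickC_congr d U1 s1 _ B t e, pickC_congr d U2 s2 _ B t e]
  have hmono : ∀ t, B t ⊆ B (t + 1) := fun t => (hleg t).1
  have hm : Monotone B := monotone_nat_of_le_succ hmono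
  have hnew : ∀ t v, v ∈ B (t + 1) → v ∉ B t → ∃ x ∈ B t, adj x v :=
    fun t v h h' => ((hleg t).2.2 v ⟨h, h'⟩).2
  have hdel : ∀ i t v, v ∈ σ ((List.range (i + 1)).map B) → i ≤ t → v ∈ B (t + 1) → v ∈ B t := by
    intro i t v hv hit hvt
    by_contra hn
    exact ((hleg t).2.2 v ⟨hvt, hn⟩).1 (mem_delSets.mpr ⟨i, by omega, hv⟩)
  have win1 : ∀ t, ∀ u ∈ U1, u ∉ B t := by
    refine window hd0 hd1 hmono hnew (fun t ht => ((hleg t).2.1).trans (w1.hM t ht))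
      (fun i t v hv => hdel i t v ?_) ?_ w1.hdisj w1.hsum
    · rw [hσ]; simp [hv]
    · rw [hB]; exact w1.hdist
  have win2 : ∀ t, ∀ u ∈ U2, u ∉ B t := by
    refine window hd0 hd1 hmono hnew (fun t ht => ((hleg t).2.1).trans (w2.hM t ht))
      (fun i t v hv => hdel i t v ?_) ?_ w2.hdisj w2.hsum
    · rw [hσ]; simp [hv]
    · rw [hB]; exact w2.hdist
  have hA0 : ∀ i, ∀ v ∈ A i, ∀ τ, ∀ x ∈ B τ, i + 1 ≤ d v x + τ := by
    intro i v hv τ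
    induction τ with
    | zero => intro x hx; rw [hB] at hx; exact hdA i v hv x hx
    | succ τ ih =>
      intro x hx
      by_cases hx' : x ∈ B τ
      · have := ih x hx'; omega
      · obtain ⟨y, hy, hyx⟩ := hnew τ x hx hx'
        have := ih y hy
        have := hd1 v y x hyx
        omega
  have hA : ∀ i, ∀ v ∈ A i, ∀ t, v ∉ B t := by
    intro i v hv t
    induction t with
    | zero => intro h; have := hA0 i v hv 0 v h; rw [hd0] at this; omega
    | succ t ih =>
      intro h
      by_cases hit : i ≤ t
      · exact ih (hdel i t v (by rw [hσ]; simp [hv]) hit h)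
      · have := hA0 i v hv (t + 1) v h; rw [hd0] at this; omega
  have hsub : ∀ t, B t ⊆ I := by
    intro t
    induction t with
    | zero => rw [hB]; exact hB0
    | succ t ih =>
      intro y hy
      by_cases hy' : y ∈ B t
      · exact ih hy'
      · obtain ⟨x, hx, hxy⟩ := hnew t y hy hy'
        rcases hclose x (ih hx) y hxy with h | ⟨i, h⟩ | h | h
        · exact h
        · exact absurd hy (hA i y h _)
        · exact absurd hy (win1 _ y h)
        · exact absurd hy (win2 _ y h)
  refine ⟨fun t => ⟨?_, ?_⟩, fun _ => Set.subset_univ _, stabilize hm hI hsub⟩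
  · rw [hσ, Set.eq_empty_iff_forall_notMem]
    rintro v ⟨hv, hvB⟩
    rw [Finset.mem_coe, Finset.mem_union, Finset.mem_union] at hv
    rcases hv with (hv | hv) | hv
    · exact hA t v hv t hvB
    · exact win1 t v (pickC_subset _ _ _ _ _ hv) hvB
    · exact win2 t v (pickC_subset _ _ _ _ _ hv) hvB
  · rw [hσ, Set.encard_coe_eq_coe_finsetCard, Nat.cast_le]
    refine (Finset.card_union_le _ _).trans ?_
    refine (Nat.add_le_add_right (Finset.card_union_le _ _) _).trans ?_
    rw [pickC_card, pickC_card]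
    exact (hbud t).trans (hq t)

/-- schedule the elements of a finset, `q` per turn. -/
lemma schedule [DecidableEq V] (M : Finset V) (q s e : ℕ) (h : M.card ≤ q * (e - s)) :
    ∃ A : ℕ → Finset V, (∀ t, (A t).card ≤ q) ∧ (∀ t, ¬ (s ≤ t ∧ t < e) → A t = ∅) ∧
      (∀ v, v ∈ M ↔ ∃ t, v ∈ A t) := by
  induction hn : e - s generalizing M e with
  | zero =>
    rw [hn] at h
    have hM : M = ∅ := Finset.card_eq_zero.mp (by omega)
    exact ⟨fun _ => ∅, by simp, by simp, by simp [hM]⟩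
  | succ n ih =>
    rw [hn] at h
    obtain ⟨N, hNM, hN⟩ : ∃ N ⊆ M, N.card = min q M.card :=
      Finset.exists_subset_card_eq (min_le_right _ _)
    have hc : (M \ N).card = M.card - N.card := Finset.card_sdiff_of_subset hNM
    have e1 : e - 1 - s = n := by omega
    obtain ⟨A, hA1, hA2, hA3⟩ := ih (M \ N) (e - 1) (by
      rw [hc, hN, e1]; rw [Nat.mul_succ] at h; omega) e1
    refine ⟨fun t => if t = e - 1 then N else A t, ?_, ?_, ?_⟩
    · intro t
      dsimp only
      split_ifs
      · omega
      · exact hA1 t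
    · intro t ht
      dsimp only
      rw [if_neg (by omega)]
      exact hA2 t (by omega)
    · intro v
      have hv := hA3 v
      rw [Finset.mem_sdiff] at hv
      constructor
      · intro hvM
        by_cases hvN : v ∈ N
        · exact ⟨e - 1, by simp [hvN]⟩
        · obtain ⟨t, ht⟩ := hv.mp ⟨hvM, hvN⟩
          refine ⟨t, ?_⟩
          have : t ≠ e - 1 := by
            rintro rfl
            rw [hA2 _ (by omega)] at ht
            simp at ht
          dsimp only
          rw [if_neg this]; exact ht
      · rintro ⟨t, ht⟩
        dsimp only at ht
        split_ifs at ht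
        · exact hNM ht
        · exact (hv.mpr ⟨t, ht⟩).1

end core

lemma budget_nat (k t : ℕ) : budget (k : ℝ) (t + 1) = k := by
  unfold budget
  have e1 : ((t + 1 : ℕ) : ℝ) * (k : ℝ) = (((t + 1) * k : ℕ) : ℝ) := by push_cast; ring
  have e2 : (((t + 1 : ℕ) : ℝ) - 1) * (k : ℝ) = ((t * k : ℕ) : ℝ) := by push_cast; ring
  rw [e1, e2, Int.floor_natCast, Int.floor_natCast]
  have : (((t + 1) * k : ℕ) : ℤ) - ((t * k : ℕ) : ℤ) = k := by push_cast; ring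
  rw [this]; simp

/-- the function `g` -/
noncomputable def gs (c : ℝ) : ℕ → ℕ∞ := fun t => (⌈c * Real.sqrt (t : ℝ)⌉₊ : ℕ∞)

lemma gs_le {c : ℝ} (hc0 : 0 < c) (t h : ℕ) (ht : t ≤ 9 * h ^ 2) :
    gs c t ≤ (⌈c * (3 * h)⌉₊ : ℕ) := by
  unfold gs
  rw [Nat.cast_le]
  apply Nat.ceil_mono
  apply mul_le_mul_of_nonneg_left _ hc0.le
  rw [show (3 * (h : ℝ)) = Real.sqrt ((3 * h) ^ 2) from (Real.sqrt_sq (by positivity)).symm]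
  apply Real.sqrt_le_sqrt
  have : (t : ℝ) ≤ 9 * (h : ℝ) ^ 2 := by exact_mod_cast ht
  nlinarith

lemma numeric {c : ℝ} (hc0 : 0 < c) (hc : c < 1 / 6) (D : ℕ) :
    ∃ H : ℕ, D ≤ H ∧ 1 ≤ H ∧
      ∀ δ ≤ D, (H + δ) * ⌈c * (3 * H)⌉₊ < ∑ j ∈ Finset.range H, (j + 1) := by
  set e : ℝ := 1 / 2 - 3 * c with he
  have hepos : 0 < e := by rw [he]; linarith
  obtain ⟨n, hn⟩ := exists_nat_gt ((1 + 2 * (D : ℝ)) / e)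
  refine ⟨n + D + 1, by omega, by omega, fun δ hδ => ?_⟩
  set H := n + D + 1 with hH
  have hs : (∑ j ∈ Finset.range H, (j + 1)) * 2 = H * (H + 1) := by
    have := Finset.sum_range_id_mul_two (H + 1)
    rw [Finset.sum_range_succ'] at this
    simpa [mul_comm] using this
  have h1 : (⌈c * (3 * (H : ℝ))⌉₊ : ℝ) < c * (3 * H) + 1 := Nat.ceil_lt_add_one (by positivity)
  have hHe : 1 + 2 * (D : ℝ) < H * e := by
    rw [div_lt_iff₀ hepos] at hn
    have : (n : ℝ) ≤ H := by rw [hH]; push_cast; linarith [Nat.cast_nonneg (α := ℝ) D]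
    nlinarith
  have hδ' : (δ : ℝ) ≤ D := by exact_mod_cast hδ
  have hδ0 : (0 : ℝ) ≤ δ := Nat.cast_nonneg _
  have hH1 : (1 : ℝ) ≤ H := by rw [hH]; push_cast; linarith [Nat.cast_nonneg (α := ℝ) D, Nat.cast_nonneg (α := ℝ) n]
  have hDH : (D : ℝ) ≤ H := by rw [hH]; push_cast; linarith [Nat.cast_nonneg (α := ℝ) n]
  have h2 : ((H : ℝ) + δ) * ⌈c * (3 * (H : ℝ))⌉₊ ≤ (H + D) * (c * (3 * H) + 1) := by
    apply mul_le_mul (by linarith) h1.le (Nat.cast_nonneg _) (by linarith)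
  have h3 : ((H : ℝ) + D) * (c * (3 * H) + 1) < H * (H + 1) / 2 := by
    have : c * (3 * (H : ℝ)) = (1 / 2 - e) * H := by rw [he]; ring
    rw [this]
    nlinarith [mul_pos hepos (by linarith : (0 : ℝ) < H), Nat.cast_nonneg (α := ℝ) D,
      mul_nonneg (Nat.cast_nonneg (α := ℝ) D) (mul_pos hepos (by linarith : (0 : ℝ) < H)).le]
  have h4 : ((∑ j ∈ Finset.range H, (j + 1) : ℕ) : ℝ) = H * (H + 1) / 2 := by
    have : ((∑ j ∈ Finset.range H, (j + 1) : ℕ) : ℝ) * 2 = H * (H + 1) := by exact_mod_cast hs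
    linarith
  have : (((H + δ) * ⌈c * (3 * (H : ℝ))⌉₊ : ℕ) : ℝ) < ((∑ j ∈ Finset.range H, (j + 1) : ℕ) : ℝ) := by
    rw [h4]; push_cast; linarith
  exact_mod_cast this

section eighth

/-- sup distance -/
def dd (a b : ℤ × ℤ) : ℕ := max (a.1 - b.1).natAbs (a.2 - b.2).natAbs

lemma spacing (H i j : ℕ) (x : ℤ) (h1 : ((2 * H * i : ℕ) : ℤ) - x < H) (h1' : x - ((2 * H * i : ℕ) : ℤ) < H)
    (h2 : ((2 * H * j : ℕ) : ℤ) - x < H) (h2' : x - ((2 * H * j : ℕ) : ℤ) < H) : i = j := by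
  rcases lt_trichotomy i j with h | h | h
  · have : 2 * H * (i + 1) ≤ 2 * H * j := Nat.mul_le_mul_left _ h
    rw [Nat.mul_add] at this
    omega
  · exact h
  · have : 2 * H * (j + 1) ≤ 2 * H * i := Nat.mul_le_mul_left _ h
    rw [Nat.mul_add] at this
    omega

/-- cell in row `N` -/
def cell8 (N i : ℕ) : ZEighth := ⟨((min i N : ℕ), (N : ℕ)), by
  constructor <;> simp⟩

theorem eighth_container {c : ℝ} (hc0 : 0 < c) (hc : c < 1 / 6) (B₀ : Set ZEighth)
    (hfin : B₀.Finite) : ContainerWins adjEighth 1 (gs c) B₀ := by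
  classical
  obtain ⟨L, hL⟩ : ∃ L : ℕ, ∀ b ∈ B₀, b.val.2 ≤ L := by
    obtain ⟨z, hz⟩ := (hfin.image (fun b => b.val.2)).bddAbove
    refine ⟨z.toNat, fun b hb => ?_⟩
    have := hz ⟨b, hb, rfl⟩
    simp only at this
    omega
  obtain ⟨H, hDH, hH1, hH⟩ := numeric hc0 hc (L + 1)
  have hsum := hH (L + 1) le_rfl
  set N := 8 * H ^ 2 with hN
  have hHH : H ≤ H ^ 2 := by nlinarith
  set n := H + (L + 1) with hn
  have hbd : ∀ i, i < n → 2 * H * i ≤ N := by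
    intro i hi
    have : i ≤ 2 * H := by omega
    calc 2 * H * i ≤ 2 * H * (2 * H) := Nat.mul_le_mul_left _ this
      _ ≤ N := by rw [hN]; nlinarith
  set R : Finset ZEighth := (Finset.range (N + 1)).image (cell8 N) with hR
  set U : Finset ZEighth := (Finset.range n).image (fun i => cell8 N (2 * H * i)) with hU
  have hRmem : ∀ v, v ∈ R → v.val.2 = N := by
    intro v hv
    rw [hR, Finset.mem_image] at hv
    obtain ⟨i, -, rfl⟩ := hv
    rfl
  have hUR : U ⊆ R := by
    intro v hv
    rw [hU, Finset.mem_image] at hv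
    obtain ⟨i, hi, rfl⟩ := hv
    rw [hR, Finset.mem_image]
    exact ⟨2 * H * i, by have := hbd i (Finset.mem_range.mp hi); rw [Finset.mem_range]; omega, rfl⟩
  have hcell : ∀ i, i < n → (cell8 N (2 * H * i)).val.1 = ((2 * H * i : ℕ) : ℤ) := by
    intro i hi
    simp only [cell8]
    rw [min_eq_left (hbd i hi)]
  have hUcard : U.card = n := by
    rw [hU, Finset.card_image_of_injOn, Finset.card_range]
    intro i hi j hj hij
    have h1 := hcell i (by simpa using hi)
    have h2 := hcell j (by simpa using hj)
    have e : cell8 N (2 * H * i) = cell8 N (2 * H * j) := hij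
    rw [e, h2] at h1
    exact spacing H i j ((2 * H * i : ℕ) : ℤ) (by omega) (by omega) (by omega) (by omega)
  have hRcard : R.card ≤ N + 1 := (Finset.card_image_le).trans (by simp)
  set s := N + 1 - n with hs
  have hMcard : (R \ U).card ≤ 1 * (s - 0) := by
    rw [Finset.card_sdiff_of_subset hUR, hUcard]; omega
  obtain ⟨A, hA1, hA2, hA3⟩ := schedule (R \ U) 1 0 s hMcard
  have hdist : ∀ v ∈ R, ∀ b ∈ B₀, N - L ≤ dd v.val b.val := by
    intro v hv b hb
    have h1 := hRmem v hv
    have h2 := hL b hb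
    unfold dd
    rw [h1]
    apply le_max_of_le_right
    omega
  have hw : WinHyp (fun a b : ZEighth => dd a.val b.val) (gs c) B₀ U s H ⌈c * (3 * (H : ℝ))⌉₊ := by
    refine ⟨?_, ?_, ?_, ?_⟩
    · intro u hu b hb
      have := hdist u (hUR hu) b hb
      omega
    · intro u hu u' hu' v h1 h2
      rw [hU, Finset.mem_image] at hu hu'
      obtain ⟨i, hi, rfl⟩ := hu
      obtain ⟨j, hj, rfl⟩ := hu'
      rw [Finset.mem_range] at hi hj
      simp only [dd, max_lt_iff] at h1 h2
      rw [hcell i hi] at h1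
      rw [hcell j hj] at h2
      rw [spacing H i j v.val.1 (by omega) (by omega) (by omega) (by omega)]
    · rw [hUcard]; exact hsum
    · intro t ht
      rw [hUcard] at ht
      apply gs_le hc0
      omega
  have hq : ∀ t, 1 ≤ budget 1 (t + 1) := by
    intro t
    have := budget_nat 1 t
    rw [Nat.cast_one] at this
    rw [this]
  refine core (I := {v | v.val.2 < N}) (d := fun a b : ZEighth => dd a.val b.val) ?_ ?_ hq A hw
    (WinHyp.empty _ _ _) ?_ ?_ ?_ ?_ ?_
  · intro u; simp [dd]
  · intro u x y hxy
    simp only [adjEighth, dd] at *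
    omega
  · intro t v hv b hb
    have ht : t < s := by
      by_contra h
      rw [hA2 t (by omega)] at hv
      simp at hv
    have := hdist v (Finset.mem_sdiff.mp ((hA3 v).mpr ⟨t, hv⟩)).1 b hb
    omega
  · intro t
    rw [hUcard]
    have := hA1 t
    by_cases ht : 0 ≤ t ∧ t < s
    · rw [if_neg (by omega), if_neg (by simp)]; omega
    · rw [hA2 t ht, if_neg (by simp : ¬(0 ≤ t ∧ t < 0 + (∅ : Finset ZEighth).card))]
      split_ifs <;> simp
  · apply Set.Finite.of_finite_image (f := Subtype.val) _ Subtype.val_injective.injOn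
    apply (Set.finite_Icc ((0 : ℤ), (0 : ℤ)) ((N : ℤ), (N : ℤ))).subset
    rintro _ ⟨v, hv, rfl⟩
    have h := v.2
    simp only [Set.mem_ofPred_eq] at hv
    simp only [Set.mem_Icc, Prod.le_def]
    omega
  · intro b hb
    have := hL b hb
    simp only [Set.mem_ofPred_eq]
    omega
  · intro x hx y hxy
    simp only [Set.mem_ofPred_eq] at hx
    by_cases hy : y.val.2 < N
    · exact Or.inl hy
    have hyN : y.val.2 = N := by
      simp only [adjEighth] at hxy
      omega
    have hyR : y ∈ R := by
      rw [hR, Finset.mem_image]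
      have h := y.2
      refine ⟨y.val.1.toNat, by rw [Finset.mem_range]; omega, ?_⟩
      apply Subtype.ext
      apply Prod.ext
      · simp only [cell8]; omega
      · simp only [cell8]; omega
    right
    by_cases hyU : y ∈ U
    · exact Or.inr (Or.inl hyU)
    · exact Or.inl ((hA3 y).mp (Finset.mem_sdiff.mpr ⟨hyR, hyU⟩))

end eighth

section strong

lemma adjStrong_bd {p q : ℤ × ℤ} (h : adjStrong p q) :
    p.1 ≤ q.1 + 1 ∧ q.1 ≤ p.1 + 1 ∧ p.2 ≤ q.2 + 1 ∧ q.2 ≤ p.2 + 1 := by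
  unfold adjStrong at h
  have h1 := abs_le.mp ((le_max_left |p.1 - q.1| |p.2 - q.2|).trans h.le)
  have h2 := abs_le.mp ((le_max_right |p.1 - q.1| |p.2 - q.2|).trans h.le)
  omega

lemma adjStrong_of {p q : ℤ × ℤ} (h : p.1 ≤ q.1 + 1 ∧ q.1 ≤ p.1 + 1 ∧ p.2 ≤ q.2 + 1 ∧ q.2 ≤ p.2 + 1)
    (hne : p.1 ≠ q.1 ∨ p.2 ≠ q.2) : adjStrong p q := by
  unfold adjStrong
  apply le_antisymm
  · apply max_le <;> rw [abs_le] <;> omega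
  · rcases hne with h | h
    · exact le_max_of_le_left (Int.one_le_abs (by omega))
    · exact le_max_of_le_right (Int.one_le_abs (by omega))

lemma strong_win {c : ℝ} (hc0 : 0 < c) {B₀ : Set (ℤ × ℤ)} {L : ℕ}
    (hL : ∀ b ∈ B₀, -(L : ℤ) ≤ b.1 ∧ b.1 ≤ L ∧ -(L : ℤ) ≤ b.2 ∧ b.2 ≤ L)
    (a : ℤ) (p H δ : ℕ) (ha : a.natAbs = p) (hp : p = 8 * H ^ 2) (hδ : δ ≤ H) (hH1 : 1 ≤ H)
    (hLp : L + H ≤ p) (hsum : (H + δ) * ⌈c * (3 * (H : ℝ))⌉₊ < ∑ j ∈ Finset.range H, (j + 1)) :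
    ∃ U : Finset (ℤ × ℤ), U.card = H + δ ∧
      WinHyp dd (gs c) B₀ U (p - L - H) H ⌈c * (3 * (H : ℝ))⌉₊ ∧
      U ⊆ {a} ×ˢ Finset.Icc (-(p : ℤ)) 0 := by
  classical
  have hHH : H ≤ H ^ 2 := by nlinarith
  have hbd : ∀ i, i < H + δ → 2 * H * i ≤ p := by
    intro i hi
    have : i ≤ 2 * H := by omega
    calc 2 * H * i ≤ 2 * H * (2 * H) := Nat.mul_le_mul_left _ this
      _ ≤ p := by rw [hp]; nlinarith
  have hUcard : ((Finset.range (H + δ)).image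
      (fun i => ((a, -((2 * H * i : ℕ) : ℤ)) : ℤ × ℤ))).card = H + δ := by
    rw [Finset.card_image_of_injOn, Finset.card_range]
    intro i hi j hj hij
    simp only [Prod.mk.injEq] at hij
    exact spacing H i j ((2 * H * i : ℕ) : ℤ) (by omega) (by omega) (by omega) (by omega)
  refine ⟨_, hUcard, ⟨?_, ?_, ?_, ?_⟩, ?_⟩
  · intro u hu b hb
    rw [Finset.mem_image] at hu
    obtain ⟨i, -, rfl⟩ := hu
    have := hL b hb
    unfold dd
    apply le_max_of_le_left
    dsimp only
    omega
  · intro u hu u' hu' v h1 h2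
    rw [Finset.mem_image] at hu hu'
    obtain ⟨i, hi, rfl⟩ := hu
    obtain ⟨j, hj, rfl⟩ := hu'
    simp only [dd, max_lt_iff] at h1 h2
    rw [spacing H i j (-v.2) (by omega) (by omega) (by omega) (by omega)]
  · rw [hUcard]; exact hsum
  · intro t ht
    rw [hUcard] at ht
    apply gs_le hc0
    omega
  · intro v hv
    rw [Finset.mem_image] at hv
    obtain ⟨i, hi, rfl⟩ := hv
    have := hbd i (by simpa using hi)
    simp only [Finset.mem_product, Finset.mem_singleton, Finset.mem_Icc]
    refine ⟨trivial, ?_, ?_⟩ <;> omega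

set_option maxHeartbeats 4000000 in
theorem strong_container {c : ℝ} (hc0 : 0 < c) (hc : c < 1 / 6) (B₀ : Set (ℤ × ℤ))
    (hfin : B₀.Finite) : ContainerWins adjStrong 3 (gs c) B₀ := by
  classical
  obtain ⟨L, hL⟩ : ∃ L : ℕ, ∀ b ∈ B₀, -(L : ℤ) ≤ b.1 ∧ b.1 ≤ L ∧ -(L : ℤ) ≤ b.2 ∧ b.2 ≤ L := by
    obtain ⟨z, hz⟩ := (hfin.image (fun b => b.1.natAbs + b.2.natAbs)).bddAbove
    refine ⟨z, fun b hb => ?_⟩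
    have := hz ⟨b, hb, rfl⟩
    simp only at this
    omega
  obtain ⟨p1, hp1⟩ : ∃ p1, p1 = 3 * L + 2 := ⟨_, rfl⟩
  obtain ⟨H2, hD2, hH2, hn2⟩ := numeric hc0 hc (2 * p1 + 1)
  have hsum2 := hn2 _ le_rfl
  obtain ⟨p2, hp2⟩ : ∃ p2, p2 = 8 * H2 ^ 2 := ⟨_, rfl⟩
  have hHH2 : 8 * H2 ≤ p2 := by rw [hp2]; nlinarith
  obtain ⟨H3, hD3, hH3, hn3⟩ := numeric hc0 hc (p1 + p2 + (2 * p1 + 1) + 1)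
  have hsum3 := hn3 _ le_rfl
  obtain ⟨p3, hp3⟩ : ∃ p3, p3 = 8 * H3 ^ 2 := ⟨_, rfl⟩
  have hHH3 : 8 * H3 ≤ p3 := by rw [hp3]; nlinarith
  obtain ⟨U2, hU2, w2, hU2s⟩ := strong_win hc0 hL (p2 : ℤ) p2 H2 (2 * p1 + 1) (by simp) hp2 hD2 hH2
    (by omega) hsum2
  obtain ⟨U3, hU3, w3, hU3s⟩ := strong_win hc0 hL (-(p3 : ℤ)) p3 H3 (p1 + p2 + (2 * p1 + 1) + 1)
    (by simp) hp3 hD3 hH3 (by omega) hsum3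
  obtain ⟨s2, hs2⟩ : ∃ s2, s2 = p2 - L - H2 := ⟨_, rfl⟩
  obtain ⟨s3, hs3⟩ : ∃ s3, s3 = p3 - L - H3 := ⟨_, rfl⟩
  rw [← hs2] at w2
  rw [← hs3] at w3
  obtain ⟨p4, hp4⟩ : ∃ p4, p4 = 2 * p3 + p2 + (p1 + p2 + (2 * p1 + 1) + 1) + 1 := ⟨_, rfl⟩
  obtain ⟨e2, he2⟩ : ∃ e2, e2 = s2 + (H2 + (2 * p1 + 1)) := ⟨_, rfl⟩
  obtain ⟨e3, he3⟩ : ∃ e3, e3 = s3 + (H3 + (p1 + p2 + (2 * p1 + 1) + 1)) := ⟨_, rfl⟩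
  -- schedules
  obtain ⟨AT, hT1, hT2, hT3⟩ := schedule (Finset.Icc (-(p1 : ℤ)) p1 ×ˢ {(p1 : ℤ)}) 3 0 (p1 - L) (by
    rw [Finset.card_product, Int.card_Icc, Finset.card_singleton]; omega)
  have hc2 : U2 ⊆ ({(p2 : ℤ)} : Finset ℤ) ×ˢ Finset.Icc (-(p2 : ℤ)) p1 :=
    hU2s.trans (Finset.product_subset_product_right (Finset.Icc_subset_Icc_right (by omega)))
  have hc3 : U3 ⊆ ({-(p3 : ℤ)} : Finset ℤ) ×ˢ Finset.Icc (-(p3 : ℤ)) p1 :=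
    hU3s.trans (Finset.product_subset_product_right (Finset.Icc_subset_Icc_right (by omega)))
  obtain ⟨AR, hR1, hR2, hR3⟩ := schedule ((({(p2 : ℤ)} : Finset ℤ) ×ˢ Finset.Icc (-(p2 : ℤ)) p1) \ U2)
    1 (p1 - L) s2 (by
      rw [Finset.card_sdiff_of_subset hc2, hU2, Finset.card_product, Int.card_Icc,
        Finset.card_singleton]; omega)
  obtain ⟨AL, hL1, hL2, hL3⟩ := schedule ((({-(p3 : ℤ)} : Finset ℤ) ×ˢ Finset.Icc (-(p3 : ℤ)) p1) \ U3)
    1 e2 s3 (by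
      rw [Finset.card_sdiff_of_subset hc3, hU3, Finset.card_product, Int.card_Icc,
        Finset.card_singleton]; omega)
  obtain ⟨AB, hB1, hB2, hB3⟩ := schedule (Finset.Icc (-(p3 : ℤ)) p2 ×ˢ {-(p4 : ℤ)}) 1 e3 (p4 - L) (by
    rw [Finset.card_product, Int.card_Icc, Finset.card_singleton]; omega)
  let tip1 : ℕ → ℤ × ℤ := fun t => if t + 1 + L ≤ p3 then (-((t + 1 + L : ℕ) : ℤ), (p1 : ℤ))
    else (-(p3 : ℤ), -((t + 1 + L : ℕ) : ℤ))
  let tip2 : ℕ → ℤ × ℤ := fun t => if t + 1 + L ≤ p2 then (((t + 1 + L : ℕ) : ℤ), (p1 : ℤ))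
    else ((p2 : ℤ), -((t + 1 + L : ℕ) : ℤ))
  let tips : ℕ → Finset (ℤ × ℤ) := fun t => if p1 - L ≤ t then {tip1 t, tip2 t} else ∅
  have htips : ∀ t, (tips t).card ≤ if p1 - L ≤ t then 2 else 0 := by
    intro t
    simp only [tips]
    split_ifs
    · exact Finset.card_le_two
    · simp
  have emp : ∀ (A : ℕ → Finset (ℤ × ℤ)) (s e : ℕ), (∀ t, ¬ (s ≤ t ∧ t < e) → A t = ∅) →
      ∀ t v, v ∈ A t → s ≤ t ∧ t < e := by
    intro A s e h t v hv
    by_contra hc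
    rw [h t hc] at hv
    simp at hv
  have crd : ∀ (A : ℕ → Finset (ℤ × ℤ)) (k s e : ℕ), (∀ t, (A t).card ≤ k) →
      (∀ t, ¬ (s ≤ t ∧ t < e) → A t = ∅) → ∀ t, (A t).card ≤ if s ≤ t ∧ t < e then k else 0 := by
    intro A k s e h h' t
    split_ifs with hc
    · exact h t
    · rw [h' t hc]; simp
  have hq : ∀ t, 3 ≤ budget 3 (t + 1) := by
    intro t
    have := budget_nat 3 t
    rw [Nat.cast_ofNat] at this
    rw [this]
  refine core (I := {v : ℤ × ℤ | -(p3 : ℤ) < v.1 ∧ v.1 < p2 ∧ -(p4 : ℤ) < v.2 ∧ v.2 < p1})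
    (d := dd) ?_ ?_ hq (fun t => AT t ∪ tips t ∪ AR t ∪ AL t ∪ AB t) w2 w3 ?_ ?_ ?_ ?_ ?_
  · intro u; simp [dd]
  · intro u x y hxy
    have := adjStrong_bd hxy
    simp only [dd]
    omega
  · intro t v hv b hb
    have hb' := hL b hb
    simp only [Finset.mem_union] at hv
    rcases hv with (((hv | hv) | hv) | hv) | hv
    · have h1 := emp AT _ _ hT2 t v hv
      have h2 := (hT3 v).mpr ⟨t, hv⟩
      simp only [Finset.mem_product, Finset.mem_singleton, Finset.mem_Icc] at h2
      unfold dd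
      apply le_max_of_le_right
      omega
    · simp only [tips] at hv
      split_ifs at hv with hpt
      · rw [Finset.mem_insert, Finset.mem_singleton] at hv
        rcases hv with rfl | rfl
        · simp only [tip1, dd]
          split_ifs
          · apply le_max_of_le_left; dsimp only; omega
          · apply le_max_of_le_right; dsimp only; omega
        · simp only [tip2, dd]
          split_ifs
          · apply le_max_of_le_left; dsimp only; omega
          · apply le_max_of_le_right; dsimp only; omega
      · simp at hv
    · have h1 := emp AR _ _ hR2 t v hv
      have h2 := (Finset.mem_sdiff.mp ((hR3 v).mpr ⟨t, hv⟩)).1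
      simp only [Finset.mem_product, Finset.mem_singleton, Finset.mem_Icc] at h2
      unfold dd
      apply le_max_of_le_left
      omega
    · have h1 := emp AL _ _ hL2 t v hv
      have h2 := (Finset.mem_sdiff.mp ((hL3 v).mpr ⟨t, hv⟩)).1
      simp only [Finset.mem_product, Finset.mem_singleton, Finset.mem_Icc] at h2
      unfold dd
      apply le_max_of_le_left
      omega
    · have h1 := emp AB _ _ hB2 t v hv
      have h2 := (hB3 v).mpr ⟨t, hv⟩
      simp only [Finset.mem_product, Finset.mem_singleton, Finset.mem_Icc] at h2
      unfold dd
      apply le_max_of_le_right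
      omega
  · intro t
    have c1 := crd AT _ _ _ hT1 hT2 t
    have c2 := htips t
    have c3 := crd AR _ _ _ hR1 hR2 t
    have c4 := crd AL _ _ _ hL1 hL2 t
    have c5 := crd AB _ _ _ hB1 hB2 t
    have d1 := Finset.card_union_le (AT t) (tips t)
    have d2 := Finset.card_union_le (AT t ∪ tips t) (AR t)
    have d3 := Finset.card_union_le (AT t ∪ tips t ∪ AR t) (AL t)
    have d4 := Finset.card_union_le (AT t ∪ tips t ∪ AR t ∪ AL t) (AB t)
    rw [hU2, hU3]
    have d5 := (d4.trans (Nat.add_le_add_right (d3.trans (Nat.add_le_add_right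
      (d2.trans (Nat.add_le_add_right d1 _)) _)) _))
    clear d1 d2 d3 d4
    generalize (AT t ∪ tips t ∪ AR t ∪ AL t ∪ AB t).card = X at *
    generalize (AT t).card = x1 at *
    generalize (tips t).card = x2 at *
    generalize (AR t).card = x3 at *
    generalize (AL t).card = x4 at *
    generalize (AB t).card = x5 at *
    clear hT1 hT2 hT3 hR1 hR2 hR3 hL1 hL2 hL3 hB1 hB2 hB3 hn2 hn3 hsum2 hsum3 hp2 hp3
    split_ifs at c1 c2 c3 c4 c5 ⊢ <;> omega
  · apply (Set.finite_Icc ((-(p3 : ℤ)), (-(p4 : ℤ))) ((p2 : ℤ), (p1 : ℤ))).subset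
    intro v hv
    simp only [Set.mem_ofPred_eq] at hv
    simp only [Set.mem_Icc, Prod.le_def]
    omega
  · intro b hb
    have := hL b hb
    simp only [Set.mem_ofPred_eq]
    omega
  · rintro ⟨x1, x2⟩ hx ⟨y1, y2⟩ hxy
    simp only [Set.mem_ofPred_eq] at hx
    by_cases hy : (y1, y2) ∈ {v : ℤ × ℤ | -(p3 : ℤ) < v.1 ∧ v.1 < p2 ∧ -(p4 : ℤ) < v.2 ∧ v.2 < p1}
    · exact Or.inl hy
    right
    simp only [Set.mem_ofPred_eq] at hy
    have hxy := adjStrong_bd hxy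
    dsimp only at hxy
    have hb : -(p3 : ℤ) ≤ y1 ∧ y1 ≤ p2 ∧ -(p4 : ℤ) ≤ y2 ∧ y2 ≤ p1 := by omega
    have hor : y2 = p1 ∨ y1 = p2 ∨ y1 = -(p3 : ℤ) ∨ y2 = -(p4 : ℤ) := by omega
    clear hxy hx hy
    have tipmem : ∀ t : ℕ, p1 - L ≤ t → (y1, y2) = tip1 t ∨ (y1, y2) = tip2 t →
        ∃ t, (y1, y2) ∈ AT t ∪ tips t ∪ AR t ∪ AL t ∪ AB t := by
      intro t ht h
      refine ⟨t, ?_⟩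
      have : (y1, y2) ∈ tips t := by
        simp only [tips]
        rw [if_pos ht, Finset.mem_insert, Finset.mem_singleton]
        exact h
      simp only [Finset.mem_union]
      tauto
    rcases hor with h | h | h | h
    · left
      by_cases h1 : -(p1 : ℤ) ≤ y1 ∧ y1 ≤ p1
      · obtain ⟨t, ht⟩ := (hT3 (y1, y2)).mp (by
          simp only [Finset.mem_product, Finset.mem_singleton, Finset.mem_Icc]; omega)
        exact ⟨t, by simp only [Finset.mem_union]; tauto⟩
      · by_cases h2 : y1 < 0
        · apply tipmem (-y1 - 1 - L).toNat (by omega)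
          left
          simp only [tip1]
          rw [if_pos (by omega), Prod.mk.injEq]
          omega
        · apply tipmem (y1 - 1 - L).toNat (by omega)
          right
          simp only [tip2]
          rw [if_pos (by omega), Prod.mk.injEq]
          omega
    · by_cases h1 : -(p2 : ℤ) ≤ y2
      · by_cases hU : (y1, y2) ∈ U2
        · exact Or.inr (Or.inl hU)
        left
        obtain ⟨t, ht⟩ := (hR3 (y1, y2)).mp (by
          rw [Finset.mem_sdiff]
          refine ⟨?_, hU⟩
          simp only [Finset.mem_product, Finset.mem_singleton, Finset.mem_Icc]; omega)
        exact ⟨t, by simp only [Finset.mem_union]; tauto⟩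
      · left
        apply tipmem (-y2 - 1 - L).toNat (by omega)
        right
        simp only [tip2]
        rw [if_neg (by omega), Prod.mk.injEq]
        omega
    · by_cases h1 : -(p3 : ℤ) ≤ y2
      · by_cases hU : (y1, y2) ∈ U3
        · exact Or.inr (Or.inr hU)
        left
        obtain ⟨t, ht⟩ := (hL3 (y1, y2)).mp (by
          rw [Finset.mem_sdiff]
          refine ⟨?_, hU⟩
          simp only [Finset.mem_product, Finset.mem_singleton, Finset.mem_Icc]; omega)
        exact ⟨t, by simp only [Finset.mem_union]; tauto⟩
      · left
        apply tipmem (-y2 - 1 - L).toNat (by omega)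
        left
        simp only [tip1]
        rw [if_neg (by omega), Prod.mk.injEq]
        omega
    · left
      obtain ⟨t, ht⟩ := (hB3 (y1, y2)).mp (by
        simp only [Finset.mem_product, Finset.mem_singleton, Finset.mem_Icc]; omega)
      exact ⟨t, by simp only [Finset.mem_union]; tauto⟩

end strong

section eighthSpreader

theorem eighth_spreader :
    ¬ ContainerWins adjEighth 1 (fun _ => ⊤) ({cell8 0 0} : Set ZEighth) := by
  classical
  intro hwin
  obtain ⟨B, F, hB0, hFm, hFc, hB, T, hT⟩ := wins_full (k := 1) (fun t => by
    simpa using budget_nat 1 t) hwin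
  have hlev : ∀ t, ∀ v ∈ B t, v.val.2 ≤ t := by
    intro t
    induction t with
    | zero => intro v hv; rw [hB0] at hv; rw [Set.mem_singleton_iff.mp hv]; simp [cell8]
    | succ t ih =>
      intro v hv
      rw [hB t] at hv
      rcases hv with hv | ⟨-, u, hu, huv⟩
      · have := ih v hv; push_cast; omega
      · have := ih u hu
        unfold adjEighth at huv
        push_cast; omega
  let X : ℕ → Finset ℕ := fun t => (Finset.range (t + 1)).filter (fun x => cell8 t x ∈ B t)
  let K : ℕ → Finset ZEighth := fun t => (F t).filter (fun v => v.val.2 ≤ t)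
  have hne : ∀ t, t + 1 ≤ (X t).card + (K t).card → (X t).Nonempty := by
    intro t h
    have h1 : (K t).card ≤ t := (Finset.card_filter_le _ _).trans (by simpa using hFc t)
    exact Finset.card_pos.mp (by omega)
  have key : ∀ t, t + 1 ≤ (X t).card + (K t).card := by
    intro t
    induction t with
    | zero =>
      have : 0 ∈ X 0 := by
        simp only [X, Finset.mem_filter, Finset.mem_range]
        exact ⟨by omega, by rw [hB0]; rfl⟩
      have := Finset.card_pos.mpr ⟨_, this⟩
      omega
    | succ t ih =>
      have hX := hne t ih
      set m := (X t).max' hX with hm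
      have hmX : m ∈ X t := Finset.max'_mem _ _
      set Y := insert (m + 1) (X t) with hY
      have hYc : Y.card = (X t).card + 1 := by
        apply Finset.card_insert_of_notMem
        intro h
        have := Finset.le_max' (X t) _ h
        omega
      have hYp : ∀ y ∈ Y, y ≤ t + 1 ∧ ∃ x ∈ X t, x ≤ t ∧ (y = x ∨ y = x + 1) := by
        intro y hy
        have hb : ∀ x ∈ X t, x ≤ t := by
          intro x hx
          simp only [X, Finset.mem_filter, Finset.mem_range] at hx
          omega
        rw [hY, Finset.mem_insert] at hy
        rcases hy with rfl | hy
        · exact ⟨by have := hb m hmX; omega, m, hmX, hb m hmX, Or.inr rfl⟩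
        · exact ⟨by have := hb y hy; omega, y, hy, hb y hy, Or.inl rfl⟩
      set Z := Y.filter (fun y => cell8 (t + 1) y ∈ F (t + 1)) with hZ
      have hsub : Y ⊆ X (t + 1) ∪ Z := by
        intro y hy
        obtain ⟨hyt, x, hx, hxt, hxy⟩ := hYp y hy
        rw [Finset.mem_union]
        by_cases hF : cell8 (t + 1) y ∈ F (t + 1)
        · right; rw [hZ, Finset.mem_filter]; exact ⟨hy, hF⟩
        · left
          simp only [X, Finset.mem_filter, Finset.mem_range] at hx ⊢
          refine ⟨by omega, ?_⟩
          rw [hB t]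
          right
          refine ⟨hF, cell8 t x, hx.2, ?_⟩
          left
          simp only [cell8]
          push_cast
          omega
      have hZimg : (Z.image (cell8 (t + 1))).card = Z.card := by
        apply Finset.card_image_of_injOn
        intro a ha b hb hab
        rw [Finset.mem_coe, hZ, Finset.mem_filter] at ha hb
        have h1 := (hYp a ha.1).1
        have h2 := (hYp b hb.1).1
        have h3 := congrArg (fun v : ZEighth => v.val.1) hab
        simp only [cell8] at h3
        omega
      have hdis : Disjoint (K t) (Z.image (cell8 (t + 1))) := by
        rw [Finset.disjoint_left]
        intro v hv hv'
        simp only [K, Finset.mem_filter] at hv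
        rw [Finset.mem_image] at hv'
        obtain ⟨y, -, rfl⟩ := hv'
        have := hv.2
        simp only [cell8] at this
        push_cast at this
        omega
      have hKsub : K t ∪ Z.image (cell8 (t + 1)) ⊆ K (t + 1) := by
        intro v hv
        rw [Finset.mem_union] at hv
        simp only [K, Finset.mem_filter] at hv ⊢
        rcases hv with hv | hv
        · exact ⟨hFm t hv.1, by have := hv.2; push_cast; omega⟩
        · rw [Finset.mem_image] at hv
          obtain ⟨y, hy, rfl⟩ := hv
          rw [hZ, Finset.mem_filter] at hy
          exact ⟨hy.2, by simp [cell8]⟩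
      have c1 := Finset.card_le_card hsub
      have c2 := Finset.card_union_le (X (t + 1)) Z
      have c3 := Finset.card_le_card hKsub
      rw [Finset.card_union_of_disjoint hdis, hZimg] at c3
      omega
  obtain ⟨x, hx⟩ := hne (T + 1) (key (T + 1))
  simp only [X, Finset.mem_filter] at hx
  have h := hx.2
  rw [hT (T + 1) (by omega)] at h
  have := hlev T _ h
  simp only [cell8] at this
  push_cast at this
  omega

end eighthSpreader

section arith

/-- the width condition -/
def WCond (nT nR nB nL s W : ℤ) : Prop :=
  4 ≤ nT + nR + nB + nL - s - W ∨
  (1 ≤ nR ∧ 1 ≤ nL ∧ 6 ≤ nT + nR + nB + nL - s - W + nR - s + min nT 1 + min nB 1 ∧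
    6 ≤ nT + nR + nB + nL - s - W + nL - s + min nT 1 + min nB 1)

/-- growth at a corner -/
def Cor (n m g h : ℤ) : Prop :=
  0 ≤ g ∧ 0 ≤ h ∧ (1 ≤ n → 1 ≤ m → 1 ≤ g ∧ 1 ≤ h) ∧ ((1 ≤ n ∨ 1 ≤ m) → 1 ≤ g + h)

lemma Cor.symm {n m g h : ℤ} (c : Cor n m g h) : Cor m n h g := by
  unfold Cor at *; omega

lemma Cor.sum {n m g h : ℤ} (c : Cor n m g h) (hn : 0 ≤ n) (hm : 0 ≤ m) :
    min n 1 + min m 1 ≤ g + h := by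
  unfold Cor at c; omega

/-- side with count `n` alive, neighbour side `m` -/
lemma Cor.side {n m g h h' m' p : ℤ} (c : Cor n m g h) (hn : 1 ≤ n) (hm : 0 ≤ m)
    (hh : 0 ≤ h') (hp : 0 ≤ p) (_ : 0 ≤ m') (hc : m + h + h' ≤ m' + p) :
    1 + min m 1 ≤ g + (p + min m' 1) := by
  unfold Cor at c; omega

lemma two_alive {nT nR nB nL s W H : ℤ} (h0 : 0 ≤ nT ∧ 0 ≤ nR ∧ 0 ≤ nB ∧ 0 ≤ nL ∧ 0 ≤ s)
    (hb : nT ≤ W ∧ nB ≤ W ∧ nR ≤ H ∧ nL ≤ H)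
    (hS : 10 ≤ 2 * (nT + nR + nB + nL - s) - W - H)
    (hW : WCond nT nR nB nL s W) (hH : WCond nR nT nL nB s H) :
    2 ≤ min nT 1 + min nR 1 + min nB 1 + min nL 1 := by
  unfold WCond at hW hH
  have a1 : min nT 1 = 0 ∧ nT = 0 ∨ min nT 1 = 1 ∧ 1 ≤ nT := by omega
  have a2 : min nR 1 = 0 ∧ nR = 0 ∨ min nR 1 = 1 ∧ 1 ≤ nR := by omega
  have a3 : min nB 1 = 0 ∧ nB = 0 ∨ min nB 1 = 1 ∧ 1 ≤ nB := by omega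
  have a4 : min nL 1 = 0 ∧ nL = 0 ∨ min nL 1 = 1 ∧ 1 ≤ nL := by omega
  generalize min nT 1 = aT at *
  generalize min nR 1 = aR at *
  generalize min nB 1 = aB at *
  generalize min nL 1 = aL at *
  rcases a1 with ⟨a1, b1⟩ | ⟨a1, b1⟩ <;> rcases a2 with ⟨a2, b2⟩ | ⟨a2, b2⟩ <;>
  rcases a3 with ⟨a3, b3⟩ | ⟨a3, b3⟩ <;> rcases a4 with ⟨a4, b4⟩ | ⟨a4, b4⟩ <;> omega

lemma wcond_step {nT nR nB nL s W H : ℤ} (h0 : 0 ≤ nT ∧ 0 ≤ nR ∧ 0 ≤ nB ∧ 0 ≤ nL ∧ 0 ≤ s)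
    (hb : nT ≤ W ∧ nB ≤ W ∧ nR ≤ H ∧ nL ≤ H)
    (hS : 10 ≤ 2 * (nT + nR + nB + nL - s) - W - H)
    (hW : WCond nT nR nB nL s W) (hH : WCond nR nT nL nB s H)
    {gTR gRT gRB gBR gBL gLB gLT gTL pT pR pB pL nT' nR' nB' nL' s' W' : ℤ}
    (c1 : Cor nT nR gTR gRT) (c2 : Cor nR nB gRB gBR) (c3 : Cor nB nL gBL gLB)
    (c4 : Cor nL nT gLT gTL)
    (hp : 0 ≤ pT ∧ 0 ≤ pR ∧ 0 ≤ pB ∧ 0 ≤ pL)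
    (hs' : s' = s + 3 - (pT + pR + pB + pL))
    (hT : nT + gTR + gTL ≤ nT' + pT) (hR : nR + gRT + gRB ≤ nR' + pR)
    (hB : nB + gBR + gBL ≤ nB' + pB) (hL : nL + gLB + gLT ≤ nL' + pL)
    (h0' : 0 ≤ nT' ∧ 0 ≤ nR' ∧ 0 ≤ nB' ∧ 0 ≤ nL' ∧ 0 ≤ s')
    (hW' : W' = W + min nR 1 + min nL 1) :
    WCond nT' nR' nB' nL' s' W' := by
  obtain ⟨zT, zR, zB, zL, zs⟩ := h0
  obtain ⟨qT, qR, qB, qL⟩ := hp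
  obtain ⟨yT, yR, yB, yL, ys⟩ := h0'
  have h2 := two_alive ⟨zT, zR, zB, zL, zs⟩ hb hS hW hH
  have s1 := c1.sum zT zR
  have s2 := c2.sum zR zB
  have s3 := c3.sum zB zL
  have s4 := c4.sum zL zT
  have g1 := c1.1
  have g2 := c2.1
  have g3 := c3.1
  have g4 := c4.1
  have k1 := c1.2.1
  have k2 := c2.2.1
  have k3 := c3.2.1
  have k4 := c4.2.1
  have kR : 1 ≤ nR → nR - s - 1 + min nT 1 + min nB 1 ≤ nR' - s' + min nT' 1 + min nB' 1 := by
    intro h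
    have e1 := c1.symm.side h zT k4 qT yT (by linarith)
    have e2 := c2.side h zB g3 qB yB (by linarith)
    linarith
  have kL : 1 ≤ nL → nL - s - 1 + min nT 1 + min nB 1 ≤ nL' - s' + min nT' 1 + min nB' 1 := by
    intro h
    have e1 := c4.side h zT g1 qT yT (by linarith)
    have e2 := c3.symm.side h zB k2 qB yB (by linarith)
    linarith
  have hV : nT + nR + nB + nL - s - W + 2 * min nT 1 + 2 * min nB 1 + min nR 1 + min nL 1 - 3
      ≤ nT' + nR' + nB' + nL' - s' - W' := by linarith
  clear s1 s2 s3 s4 c1 c2 c3 c4 g1 g2 g3 g4 k1 k2 k3 k4 hT hR hB hL hs' hW' qT qR qB qL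
  unfold WCond at *
  generalize nT' + nR' + nB' + nL' - s' - W' = V' at *
  have b1 : min nT' 1 ≤ 1 := by omega
  have b2 : min nB' 1 ≤ 1 := by omega
  have a1 : min nT 1 = 0 ∧ nT = 0 ∨ min nT 1 = 1 ∧ 1 ≤ nT := by omega
  have a2 : min nR 1 = 0 ∧ nR = 0 ∨ min nR 1 = 1 ∧ 1 ≤ nR := by omega
  have a3 : min nB 1 = 0 ∧ nB = 0 ∨ min nB 1 = 1 ∧ 1 ≤ nB := by omega
  have a4 : min nL 1 = 0 ∧ nL = 0 ∨ min nL 1 = 1 ∧ 1 ≤ nL := by omega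
  generalize min nT' 1 = xT at *
  generalize min nB' 1 = xB at *
  generalize min nT 1 = aT at *
  generalize min nR 1 = aR at *
  generalize min nB 1 = aB at *
  generalize min nL 1 = aL at *
  by_cases hV4 : 4 ≤ V'
  · exact Or.inl hV4
  right
  have hRL : 1 ≤ nR ∧ 1 ≤ nL ∧ aR = 1 ∧ aL = 1 := by
    rcases a1 with ⟨a1, b1⟩ | ⟨a1, b1⟩ <;> rcases a2 with ⟨a2, b2⟩ | ⟨a2, b2⟩ <;>
    rcases a3 with ⟨a3, b3⟩ | ⟨a3, b3⟩ <;> rcases a4 with ⟨a4, b4⟩ | ⟨a4, b4⟩ <;> omega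
  obtain ⟨r1, r2, r3, r4⟩ := hRL
  have kR := kR r1
  have kL := kL r2
  clear a2 a4
  rcases a1 with ⟨a1, b1⟩ | ⟨a1, b1⟩ <;> rcases a3 with ⟨a3, b3⟩ | ⟨a3, b3⟩ <;> omega

lemma s_step {nT nR nB nL s W H : ℤ} (h0 : 0 ≤ nT ∧ 0 ≤ nR ∧ 0 ≤ nB ∧ 0 ≤ nL ∧ 0 ≤ s)
    (hb : nT ≤ W ∧ nB ≤ W ∧ nR ≤ H ∧ nL ≤ H)
    (hS : 10 ≤ 2 * (nT + nR + nB + nL - s) - W - H)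
    (hW : WCond nT nR nB nL s W) (hH : WCond nR nT nL nB s H)
    {gTR gRT gRB gBR gBL gLB gLT gTL pT pR pB pL nT' nR' nB' nL' s' W' H' : ℤ}
    (c1 : Cor nT nR gTR gRT) (c2 : Cor nR nB gRB gBR) (c3 : Cor nB nL gBL gLB)
    (c4 : Cor nL nT gLT gTL)
    (hs' : s' = s + 3 - (pT + pR + pB + pL))
    (hT : nT + gTR + gTL ≤ nT' + pT) (hR : nR + gRT + gRB ≤ nR' + pR)
    (hB : nB + gBR + gBL ≤ nB' + pB) (hL : nL + gLB + gLT ≤ nL' + pL)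
    (hW' : W' = W + min nR 1 + min nL 1) (hH' : H' = H + min nT 1 + min nB 1) :
    10 ≤ 2 * (nT' + nR' + nB' + nL' - s') - W' - H' := by
  have h2 := two_alive h0 hb hS hW hH
  obtain ⟨zT, zR, zB, zL, zs⟩ := h0
  have s1 := c1.sum zT zR
  have s2 := c2.sum zR zB
  have s3 := c3.sum zB zL
  have s4 := c4.sum zL zT
  linarith

end arith

section sides

/-- liveness of a side -/
noncomputable def al (N : Finset ℤ) : ℤ := min (N.card : ℤ) 1

lemma al_empty : al ∅ = 0 := by simp [al]

lemma al_nonempty {N : Finset ℤ} (h : N.Nonempty) : al N = 1 := by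
  have := h.card_pos
  unfold al; omega

lemma al_bd (N : Finset ℤ) : 0 ≤ al N ∧ al N ≤ 1 := by unfold al; omega

open Classical in
/-- growth of a side at a corner -/
noncomputable def gro (N : Finset ℤ) (e : ℤ) (M : Finset ℤ) (f : ℤ) : ℤ :=
  if N.Nonempty then (if M.Nonempty ∨ e ∉ N then 1 else 0) else (if f ∈ M then 1 else 0)

lemma gro_bd (N : Finset ℤ) (e : ℤ) (M : Finset ℤ) (f : ℤ) : gro N e M f = 0 ∨ gro N e M f = 1 := by
  unfold gro; split_ifs <;> simp

lemma gro_cor (N : Finset ℤ) (e : ℤ) (M : Finset ℤ) (f : ℤ) :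
    Cor N.card M.card (gro N e M f) (gro M f N e) := by
  unfold Cor gro
  by_cases hN : N.Nonempty <;> by_cases hM : M.Nonempty
  · simp [hN, hM]
  · rw [Finset.not_nonempty_iff_eq_empty] at hM
    subst hM
    simp only [hN, if_true]
    by_cases he : e ∈ N <;> simp [he]
  · rw [Finset.not_nonempty_iff_eq_empty] at hN
    subst hN
    simp only [hM, if_true]
    by_cases he : f ∈ M <;> simp [he]
  · rw [Finset.not_nonempty_iff_eq_empty] at hN hM
    subst hN; subst hM
    simp

lemma cand_exists (N : Finset ℤ) (lo hi : ℤ) (hN : ∀ x ∈ N, lo ≤ x ∧ x ≤ hi) (hlh : lo ≤ hi)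
    (Ml Mh : Finset ℤ) (fl fh : ℤ) :
    ∃ C : Finset ℤ, (C.card : ℤ) = N.card + gro N hi Mh fh + gro N lo Ml fl ∧
      (∀ x ∈ C, lo - al Ml ≤ x ∧ x ≤ hi + al Mh) ∧
      (∀ x ∈ C, (∃ y ∈ N, x ≤ y + 1 ∧ y ≤ x + 1) ∨
        (N = ∅ ∧ ((x = hi + 1 ∧ fh ∈ Mh) ∨ (x = lo - 1 ∧ fl ∈ Ml)))) := by
  classical
  have bl := al_bd Ml
  have bh := al_bd Mh
  by_cases hne : N.Nonempty
  · set a := N.max' hne with ha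
    set b := N.min' hne with hb
    have haN : a ∈ N := Finset.max'_mem _ _
    have hbN : b ∈ N := Finset.min'_mem _ _
    have hle : ∀ x ∈ N, b ≤ x ∧ x ≤ a := fun x hx => ⟨Finset.min'_le _ _ hx, Finset.le_max' _ _ hx⟩
    have hab := (hle a haN).1
    have h1 := hN a haN
    have h2 := hN b hbN
    let C1 : Finset ℤ := if gro N hi Mh fh = 1 then {a + 1} else ∅
    let C2 : Finset ℤ := if gro N lo Ml fl = 1 then {b - 1} else ∅
    have hC1 : ∀ x ∈ C1, x = a + 1 ∧ (Mh.Nonempty ∨ hi ∉ N) := by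
      intro x hx
      simp only [C1] at hx
      split_ifs at hx with h
      · refine ⟨Finset.mem_singleton.mp hx, ?_⟩
        unfold gro at h
        rw [if_pos hne] at h
        by_contra hc
        rw [if_neg hc] at h
        omega
      · simp at hx
    have hC2 : ∀ x ∈ C2, x = b - 1 ∧ (Ml.Nonempty ∨ lo ∉ N) := by
      intro x hx
      simp only [C2] at hx
      split_ifs at hx with h
      · refine ⟨Finset.mem_singleton.mp hx, ?_⟩
        unfold gro at h
        rw [if_pos hne] at h
        by_contra hc
        rw [if_neg hc] at h
        omega
      · simp at hx
    have k1 : (C1.card : ℤ) = gro N hi Mh fh := by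
      simp only [C1]
      rcases gro_bd N hi Mh fh with h | h <;> rw [h] <;> simp
    have k2 : (C2.card : ℤ) = gro N lo Ml fl := by
      simp only [C2]
      rcases gro_bd N lo Ml fl with h | h <;> rw [h] <;> simp
    have d1 : Disjoint N C1 := by
      rw [Finset.disjoint_left]
      intro x hx hx'
      have := hC1 x hx'
      have := hle x hx
      omega
    have d2 : Disjoint (N ∪ C1) C2 := by
      rw [Finset.disjoint_left]
      intro x hx hx'
      have := hC2 x hx'
      rw [Finset.mem_union] at hx
      rcases hx with hx | hx
      · have := hle x hx
        omega
      · have := hC1 x hx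
        omega
    refine ⟨N ∪ C1 ∪ C2, ?_, ?_, ?_⟩
    · rw [Finset.card_union_of_disjoint d2, Finset.card_union_of_disjoint d1]
      push_cast
      rw [k1, k2]
    · intro x hx
      rw [Finset.mem_union, Finset.mem_union] at hx
      rcases hx with (hx | hx) | hx
      · have := hN x hx; omega
      · obtain ⟨hx, h | h⟩ := hC1 x hx
        · rw [al_nonempty h] at *; omega
        · have : a ≠ hi := fun e => h (e ▸ haN)
          omega
      · obtain ⟨hx, h | h⟩ := hC2 x hx
        · rw [al_nonempty h] at *; omega
        · have : b ≠ lo := fun e => h (e ▸ hbN)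
          omega
    · intro x hx
      left
      rw [Finset.mem_union, Finset.mem_union] at hx
      rcases hx with (hx | hx) | hx
      · exact ⟨x, hx, by omega, by omega⟩
      · exact ⟨a, haN, by have := hC1 x hx; omega, by have := hC1 x hx; omega⟩
      · exact ⟨b, hbN, by have := hC2 x hx; omega, by have := hC2 x hx; omega⟩
  · have hemp := Finset.not_nonempty_iff_eq_empty.mp hne
    let C1 : Finset ℤ := if fh ∈ Mh then {hi + 1} else ∅
    let C2 : Finset ℤ := if fl ∈ Ml then {lo - 1} else ∅
    have hC1 : ∀ x ∈ C1, x = hi + 1 ∧ fh ∈ Mh := by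
      intro x hx
      simp only [C1] at hx
      split_ifs at hx with h
      · exact ⟨Finset.mem_singleton.mp hx, h⟩
      · simp at hx
    have hC2 : ∀ x ∈ C2, x = lo - 1 ∧ fl ∈ Ml := by
      intro x hx
      simp only [C2] at hx
      split_ifs at hx with h
      · exact ⟨Finset.mem_singleton.mp hx, h⟩
      · simp at hx
    have k1 : (C1.card : ℤ) = gro N hi Mh fh := by
      simp only [C1, gro]
      rw [if_neg hne]
      split_ifs <;> simp
    have k2 : (C2.card : ℤ) = gro N lo Ml fl := by
      simp only [C2, gro]
      rw [if_neg hne]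
      split_ifs <;> simp
    have d2 : Disjoint C1 C2 := by
      rw [Finset.disjoint_left]
      intro x hx hx'
      have := hC2 x hx'
      have := hC1 x hx
      omega
    refine ⟨C1 ∪ C2, ?_, ?_, ?_⟩
    · rw [Finset.card_union_of_disjoint d2]
      push_cast
      rw [k1, k2, hemp]
      simp
    · intro x hx
      rw [Finset.mem_union] at hx
      rcases hx with hx | hx
      · obtain ⟨hx, h⟩ := hC1 x hx
        have := al_nonempty ⟨_, h⟩
        omega
      · obtain ⟨hx, h⟩ := hC2 x hx
        have := al_nonempty ⟨_, h⟩
        omega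
    · intro x hx
      right
      refine ⟨hemp, ?_⟩
      rw [Finset.mem_union] at hx
      rcases hx with hx | hx
      · exact Or.inl (hC1 x hx)
      · exact Or.inr (hC2 x hx)

/-- a side of the box -/
structure SideOK (φ : ℤ → ℤ → ℤ × ℤ) (B : ℕ → Set (ℤ × ℤ)) (t : ℕ) (N : Finset ℤ)
    (lo hi h : ℤ) : Prop where
  sub : ∀ x ∈ N, lo ≤ x ∧ x ≤ hi
  occ : ∀ x ∈ N, φ x (h + 1) ∈ B (t + 1)
  ext : ∃ x, φ x h ∈ B t

lemma side_step {φ : ℤ → ℤ → ℤ × ℤ}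
    (hφ : ∀ x y a b, x ≤ y + 1 → y ≤ x + 1 → a ≤ b + 1 → b ≤ a + 1 → (x ≠ y ∨ a ≠ b) →
      adjStrong (φ x a) (φ y b))
    {B : ℕ → Set (ℤ × ℤ)} {F : ℕ → Finset (ℤ × ℤ)}
    (hB : ∀ t, B (t + 1) = B t ∪ {v | v ∉ F (t + 1) ∧ ∃ u ∈ B t, adjStrong u v})
    {t : ℕ} {N : Finset ℤ} {lo hi h : ℤ} (hS : SideOK φ B t N lo hi h) (hlh : lo ≤ hi)
    (Ml Mh : Finset ℤ) (fl fh : ℤ)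
    (jh : fh ∈ Mh → φ (hi + 1) h ∈ B (t + 1)) (jl : fl ∈ Ml → φ (lo - 1) h ∈ B (t + 1)) :
    ∃ N' P : Finset ℤ, SideOK φ B (t + 1) N' (lo - al Ml) (hi + al Mh) (h + al N) ∧
      (N.card : ℤ) + gro N hi Mh fh + gro N lo Ml fl ≤ N'.card + P.card ∧
      ∀ x ∈ P, φ x (h + al N + 1) ∈ F (t + 2) ∧ (lo - al Ml ≤ x ∧ x ≤ hi + al Mh) ∧
        (al N = 1 ∨ (al N = 0 ∧ (x = hi + 1 ∨ x = lo - 1))) := by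
  classical
  obtain ⟨C, hC1, hC2, hC3⟩ := cand_exists N lo hi hS.sub hlh Ml Mh fl fh
  refine ⟨C.filter (fun x => φ x (h + al N + 1) ∉ F (t + 2)),
    C.filter (fun x => φ x (h + al N + 1) ∈ F (t + 2)), ⟨?_, ?_, ?_⟩, ?_, ?_⟩
  · intro x hx
    exact hC2 x (Finset.mem_filter.mp hx).1
  · intro x hx
    obtain ⟨hx, hxF⟩ := Finset.mem_filter.mp hx
    rw [hB (t + 1)]
    right
    refine ⟨hxF, ?_⟩
    rcases hC3 x hx with ⟨y, hy, h1, h2⟩ | ⟨hN, ⟨rfl, hj⟩ | ⟨rfl, hj⟩⟩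
    · refine ⟨_, hS.occ y hy, ?_⟩
      rw [al_nonempty ⟨y, hy⟩]
      apply hφ <;> omega
    · refine ⟨_, jh hj, ?_⟩
      rw [hN, al_empty]
      apply hφ <;> omega
    · refine ⟨_, jl hj, ?_⟩
      rw [hN, al_empty]
      apply hφ <;> omega
  · by_cases hne : N.Nonempty
    · obtain ⟨y, hy⟩ := hne
      exact ⟨y, by rw [al_nonempty ⟨y, hy⟩]; exact hS.occ y hy⟩
    · rw [Finset.not_nonempty_iff_eq_empty] at hne
      obtain ⟨x, hx⟩ := hS.ext
      refine ⟨x, ?_⟩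
      rw [hne, al_empty, hB t]
      left
      simpa using hx
  · rw [← hC1]
    have := Finset.card_filter_add_card_filter_not (s := C) (fun x => φ x (h + al N + 1) ∈ F (t + 2))
    omega
  · intro x hx
    obtain ⟨hx, hxF⟩ := Finset.mem_filter.mp hx
    refine ⟨hxF, hC2 x hx, ?_⟩
    rcases hC3 x hx with ⟨y, hy, -⟩ | ⟨hN, h⟩
    · left; exact al_nonempty ⟨y, hy⟩
    · right
      refine ⟨by rw [hN, al_empty], ?_⟩
      tauto

end sides

section strongSpreader

def phT (x a : ℤ) : ℤ × ℤ := (x, a)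
def phB (x a : ℤ) : ℤ × ℤ := (x, -a)
def phR (x a : ℤ) : ℤ × ℤ := (a, x)
def phL (x a : ℤ) : ℤ × ℤ := (-a, x)

/-- the region of cells charged so far -/
def Reg (l r b u : ℤ) (v : ℤ × ℤ) : Prop :=
  (-l ≤ v.1 ∧ v.1 ≤ r ∧ -b - 1 ≤ v.2 ∧ v.2 ≤ u + 1) ∨
  (-l - 1 ≤ v.1 ∧ v.1 ≤ r + 1 ∧ -b ≤ v.2 ∧ v.2 ≤ u)

structure St (B : ℕ → Set (ℤ × ℤ)) (F : ℕ → Finset (ℤ × ℤ)) (t : ℕ) (l r b u : ℤ)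
    (NT NR NB NL : Finset ℤ) (K : Finset (ℤ × ℤ)) : Prop where
  box : 0 ≤ l ∧ 0 ≤ r ∧ 0 ≤ b ∧ 0 ≤ u
  size : 2 * (t : ℤ) ≤ l + r + b + u
  sT : SideOK phT B t NT (-l) r u
  sR : SideOK phR B t NR (-b) u r
  sB : SideOK phB B t NB (-l) r b
  sL : SideOK phL B t NL (-b) u l
  hK : K ⊆ F (t + 1)
  hReg : ∀ v ∈ K, Reg l r b u v
  hS : 10 ≤ 2 * ((NT.card : ℤ) + NR.card + NB.card + NL.card - (3 * (t + 1) - K.card))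
    - (l + r + 1) - (b + u + 1)
  hW : WCond NT.card NR.card NB.card NL.card (3 * (t + 1) - K.card) (l + r + 1)
  hH : WCond NR.card NT.card NL.card NB.card (3 * (t + 1) - K.card) (b + u + 1)

lemma card_le_of_sub {N : Finset ℤ} {lo hi : ℤ} (h : ∀ x ∈ N, lo ≤ x ∧ x ≤ hi) (hl : lo ≤ hi) :
    (N.card : ℤ) ≤ hi - lo + 1 := by
  have h1 : N ⊆ Finset.Icc lo hi := fun x hx => Finset.mem_Icc.mpr (h x hx)
  have := Finset.card_le_card h1
  rw [Int.card_Icc] at this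
  omega

lemma st_step {B : ℕ → Set (ℤ × ℤ)} {F : ℕ → Finset (ℤ × ℤ)}
    (hB : ∀ t, B (t + 1) = B t ∪ {v | v ∉ F (t + 1) ∧ ∃ u ∈ B t, adjStrong u v})
    (hFm : ∀ t, F t ⊆ F (t + 1)) (hFc : ∀ t, (F t).card ≤ 3 * t)
    {t : ℕ} {l r b u : ℤ} {NT NR NB NL : Finset ℤ} {K : Finset (ℤ × ℤ)}
    (st : St B F t l r b u NT NR NB NL K) :
    ∃ l' r' b' u' NT' NR' NB' NL' K', St B F (t + 1) l' r' b' u' NT' NR' NB' NL' K' := by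
  classical
  obtain ⟨bl, br, bb, bu⟩ := st.box
  obtain ⟨NT', PT, T1, T2, T3⟩ := side_step (φ := phT)
    (fun x y a b h1 h2 h3 h4 h5 => adjStrong_of (by simp only [phT]; omega) (by simp only [phT]; omega))
    hB st.sT (by omega) NL NR u u (fun h => st.sR.occ u h)
    (fun h => by have := st.sL.occ u h; simp only [phT, phL] at this ⊢; convert this using 2; ring)
  obtain ⟨NR', PR, R1, R2, R3⟩ := side_step (φ := phR)
    (fun x y a b h1 h2 h3 h4 h5 => adjStrong_of (by simp only [phR]; omega) (by simp only [phR]; omega))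
    hB st.sR (by omega) NB NT r r (fun h => st.sT.occ r h)
    (fun h => by have := st.sB.occ r h; simp only [phR, phB] at this ⊢; convert this using 2; ring)
  obtain ⟨NB', PB, B1, B2, B3⟩ := side_step (φ := phB)
    (fun x y a b h1 h2 h3 h4 h5 => adjStrong_of (by simp only [phB]; omega) (by simp only [phB]; omega))
    hB st.sB (by omega) NL NR (-b) (-b) (fun h => st.sR.occ (-b) h)
    (fun h => by have := st.sL.occ (-b) h; simp only [phB, phL] at this ⊢; convert this using 2; ring)
  obtain ⟨NL', PL, L1, L2, L3⟩ := side_step (φ := phL)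
    (fun x y a b h1 h2 h3 h4 h5 => adjStrong_of (by simp only [phL]; omega) (by simp only [phL]; omega))
    hB st.sL (by omega) NB NT (-l) (-l) (fun h => st.sT.occ (-l) h)
    (fun h => by have := st.sB.occ (-l) h; simp only [phL, phB] at this ⊢; convert this using 2; ring)
  have aT := al_bd NT
  have aR := al_bd NR
  have aB := al_bd NB
  have aL := al_bd NL
  -- the charged cells
  set QT := PT.image (fun x => phT x (u + al NT + 1)) with hQT
  set QR := PR.image (fun x => phR x (r + al NR + 1)) with hQR
  set QB := PB.image (fun x => phB x (b + al NB + 1)) with hQB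
  set QL := PL.image (fun x => phL x (l + al NL + 1)) with hQL
  have cT : QT.card = PT.card := Finset.card_image_of_injective _ (fun x y h => by
    simpa [phT] using h)
  have cR : QR.card = PR.card := Finset.card_image_of_injective _ (fun x y h => by
    simpa [phR] using h)
  have cB : QB.card = PB.card := Finset.card_image_of_injective _ (fun x y h => by
    simpa [phB] using h)
  have cL : QL.card = PL.card := Finset.card_image_of_injective _ (fun x y h => by
    simpa [phL] using h)
  have mT : ∀ v ∈ QT, v ∈ F (t + 2) ∧ v.2 = u + al NT + 1 ∧ -(l + al NL) ≤ v.1 ∧ v.1 ≤ r + al NR ∧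
      (al NT = 1 ∨ (al NT = 0 ∧ (v.1 = r + 1 ∨ v.1 = -l - 1))) := by
    intro v hv
    rw [hQT, Finset.mem_image] at hv
    obtain ⟨x, hx, rfl⟩ := hv
    have := T3 x hx
    refine ⟨this.1, rfl, ?_⟩
    simp only [phT]
    omega
  have mR : ∀ v ∈ QR, v ∈ F (t + 2) ∧ v.1 = r + al NR + 1 ∧ -(b + al NB) ≤ v.2 ∧ v.2 ≤ u + al NT ∧
      (al NR = 1 ∨ (al NR = 0 ∧ (v.2 = u + 1 ∨ v.2 = -b - 1))) := by
    intro v hv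
    rw [hQR, Finset.mem_image] at hv
    obtain ⟨x, hx, rfl⟩ := hv
    have := R3 x hx
    refine ⟨this.1, rfl, ?_⟩
    simp only [phR]
    omega
  have mB : ∀ v ∈ QB, v ∈ F (t + 2) ∧ v.2 = -(b + al NB + 1) ∧ -(l + al NL) ≤ v.1 ∧ v.1 ≤ r + al NR ∧
      (al NB = 1 ∨ (al NB = 0 ∧ (v.1 = r + 1 ∨ v.1 = -l - 1))) := by
    intro v hv
    rw [hQB, Finset.mem_image] at hv
    obtain ⟨x, hx, rfl⟩ := hv
    have := B3 x hx
    refine ⟨this.1, rfl, ?_⟩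
    simp only [phB]
    omega
  have mL : ∀ v ∈ QL, v ∈ F (t + 2) ∧ v.1 = -(l + al NL + 1) ∧ -(b + al NB) ≤ v.2 ∧ v.2 ≤ u + al NT ∧
      (al NL = 1 ∨ (al NL = 0 ∧ (v.2 = u + 1 ∨ v.2 = -b - 1))) := by
    intro v hv
    rw [hQL, Finset.mem_image] at hv
    obtain ⟨x, hx, rfl⟩ := hv
    have := L3 x hx
    refine ⟨this.1, rfl, ?_⟩
    simp only [phL]
    omega
  have d1 : Disjoint K QT := by
    rw [Finset.disjoint_left]; intro v h1 h2
    have := st.hReg v h1; have := mT v h2; unfold Reg at *; omega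
  have d2 : Disjoint (K ∪ QT) QR := by
    rw [Finset.disjoint_left]; intro v h1 h2
    have h2 := mR v h2
    rw [Finset.mem_union] at h1
    rcases h1 with h1 | h1
    · have := st.hReg v h1; unfold Reg at *; omega
    · have := mT v h1; omega
  have d3 : Disjoint (K ∪ QT ∪ QR) QB := by
    rw [Finset.disjoint_left]; intro v h1 h2
    have h2 := mB v h2
    rw [Finset.mem_union, Finset.mem_union] at h1
    rcases h1 with (h1 | h1) | h1
    · have := st.hReg v h1; unfold Reg at *; omega
    · have := mT v h1; omega
    · have := mR v h1; omega
  have d4 : Disjoint (K ∪ QT ∪ QR ∪ QB) QL := by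
    rw [Finset.disjoint_left]; intro v h1 h2
    have h2 := mL v h2
    rw [Finset.mem_union, Finset.mem_union, Finset.mem_union] at h1
    rcases h1 with ((h1 | h1) | h1) | h1
    · have := st.hReg v h1; unfold Reg at *; omega
    · have := mT v h1; omega
    · have := mR v h1; omega
    · have := mB v h1; omega
  have hKc : (K ∪ QT ∪ QR ∪ QB ∪ QL).card = K.card + PT.card + PR.card + PB.card + PL.card := by
    rw [Finset.card_union_of_disjoint d4, Finset.card_union_of_disjoint d3,
      Finset.card_union_of_disjoint d2, Finset.card_union_of_disjoint d1, cT, cR, cB, cL]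
  set K' := K ∪ QT ∪ QR ∪ QB ∪ QL with hK'
  have hK'F : K' ⊆ F (t + 2) := by
    intro v hv
    rw [hK'] at hv
    simp only [Finset.mem_union] at hv
    rcases hv with (((hv | hv) | hv) | hv) | hv
    · exact hFm _ (st.hK hv)
    · exact (mT v hv).1
    · exact (mR v hv).1
    · exact (mB v hv).1
    · exact (mL v hv).1
  have s0 : 0 ≤ (3 * ((t : ℤ) + 1) - K.card) := by
    have := (Finset.card_le_card st.hK).trans (hFc (t + 1)); omega
  have s0' : 0 ≤ (3 * (((t + 1 : ℕ) : ℤ) + 1) - K'.card) := by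
    have := (Finset.card_le_card hK'F).trans (hFc (t + 2)); omega
  have h0 : 0 ≤ (NT.card : ℤ) ∧ 0 ≤ (NR.card : ℤ) ∧ 0 ≤ (NB.card : ℤ) ∧ 0 ≤ (NL.card : ℤ) ∧
      0 ≤ (3 * ((t : ℤ) + 1) - K.card) := by omega
  have h0' : 0 ≤ (NT'.card : ℤ) ∧ 0 ≤ (NR'.card : ℤ) ∧ 0 ≤ (NB'.card : ℤ) ∧ 0 ≤ (NL'.card : ℤ) ∧
      0 ≤ (3 * (((t + 1 : ℕ) : ℤ) + 1) - K'.card) := by omega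
  have w1 := card_le_of_sub st.sT.sub (by omega)
  have w2 := card_le_of_sub st.sR.sub (by omega)
  have w3 := card_le_of_sub st.sB.sub (by omega)
  have w4 := card_le_of_sub st.sL.sub (by omega)
  have hb : (NT.card : ℤ) ≤ l + r + 1 ∧ (NB.card : ℤ) ≤ l + r + 1 ∧ (NR.card : ℤ) ≤ b + u + 1 ∧
      (NL.card : ℤ) ≤ b + u + 1 := by omega
  have h2 := two_alive h0 hb st.hS st.hW st.hH
  have cor1 := gro_cor NT r NR u
  have cor2 := gro_cor NR (-b) NB r
  have cor3 := gro_cor NB (-l) NL (-b)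
  have cor4 := gro_cor NL u NT (-l)
  have hs' : (3 * (((t + 1 : ℕ) : ℤ) + 1) - K'.card) = (3 * ((t : ℤ) + 1) - K.card) + 3 -
      ((PT.card : ℤ) + PR.card + PB.card + PL.card) := by
    rw [hKc]; push_cast; ring
  refine ⟨l + al NL, r + al NR, b + al NB, u + al NT, NT', NR', NB', NL', K',
    ⟨by omega, ?_, ?_, ?_, ?_, ?_, hK'F, ?_, ?_, ?_, ?_⟩⟩
  · have := st.size
    unfold al
    push_cast
    omega
  · convert T1 using 1; ring
  · convert R1 using 1; ring
  · convert B1 using 1; ring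
  · convert L1 using 1; ring
  · intro v hv
    rw [hK'] at hv
    simp only [Finset.mem_union] at hv
    unfold Reg
    rcases hv with (((hv | hv) | hv) | hv) | hv
    · have := st.hReg v hv
      unfold Reg at this
      omega
    · have := mT v hv; omega
    · have := mR v hv; omega
    · have := mB v hv; omega
    · have := mL v hv; omega
  · exact s_step h0 hb st.hS st.hW st.hH cor1 cor2 cor3 cor4 hs' (by linarith) (by linarith)
      (by linarith) (by linarith) (by unfold al; ring) (by unfold al; ring)
  · exact wcond_step h0 hb st.hS st.hW st.hH cor1 cor2 cor3 cor4 (by omega) hs' (by linarith)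
      (by linarith) (by linarith) (by linarith) h0' (by unfold al; ring)
  · refine wcond_step (H := l + r + 1) (W := b + u + 1) (pT := PR.card) (pR := PT.card)
      (pB := PL.card) (pL := PB.card) ⟨h0.2.1, h0.1, h0.2.2.2.1, h0.2.2.1, h0.2.2.2.2⟩
      ⟨hb.2.2.1, hb.2.2.2, hb.1, hb.2.1⟩ (by linarith [st.hS]) st.hH st.hW cor1.symm cor4.symm
      cor3.symm cor2.symm (by omega) (by rw [hs']; ring) (by linarith)
      (by linarith) (by linarith) (by linarith)
      ⟨h0'.2.1, h0'.1, h0'.2.2.2.1, h0'.2.2.1, h0'.2.2.2.2⟩ (by unfold al; ring)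

lemma st_init_side {φ : ℤ → ℤ → ℤ × ℤ} (hinj : ∀ a, Function.Injective (fun x => φ x a))
    (hφ : ∀ x, adjStrong (φ x 10) (φ x 11)) {B : ℕ → Set (ℤ × ℤ)} {F : ℕ → Finset (ℤ × ℤ)}
    (hB : ∀ t, B (t + 1) = B t ∪ {v | v ∉ F (t + 1) ∧ ∃ u ∈ B t, adjStrong u v})
    (hFc : ∀ t, (F t).card ≤ 3 * t) (h0 : ∀ x, -10 ≤ x → x ≤ 10 → φ x 10 ∈ B 0) :
    ∃ N : Finset ℤ, SideOK φ B 0 N (-10) 10 10 ∧ 18 ≤ N.card := by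
  classical
  refine ⟨(Finset.Icc (-10 : ℤ) 10).filter (fun x => φ x 11 ∉ F 1), ⟨?_, ?_, ?_⟩, ?_⟩
  · intro x hx
    exact Finset.mem_Icc.mp (Finset.mem_filter.mp hx).1
  · intro x hx
    obtain ⟨hx, hxF⟩ := Finset.mem_filter.mp hx
    rw [Finset.mem_Icc] at hx
    rw [hB 0]
    exact Or.inr ⟨hxF, _, h0 x hx.1 hx.2, hφ x⟩
  · exact ⟨0, h0 0 (by omega) (by omega)⟩
  · have h1 := Finset.card_filter_add_card_filter_not (s := Finset.Icc (-10 : ℤ) 10) (fun x => φ x 11 ∈ F 1)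
    rw [Int.card_Icc] at h1
    have h2 : ((Finset.Icc (-10 : ℤ) 10).filter (fun x => φ x 11 ∈ F 1)).card ≤ 3 := by
      rw [← Finset.card_image_of_injective _ (hinj 11)]
      refine le_trans (Finset.card_le_card ?_) (hFc 1)
      intro v hv
      rw [Finset.mem_image] at hv
      obtain ⟨x, hx, rfl⟩ := hv
      exact (Finset.mem_filter.mp hx).2
    omega

theorem strong_spreader :
    ¬ ContainerWins adjStrong 3 (fun _ => ⊤) (Set.Icc ((-10 : ℤ), (-10 : ℤ)) ((10 : ℤ), (10 : ℤ))) := by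
  classical
  intro hwin
  obtain ⟨B, F, hB0, hFm, hFc, hB, T, hT⟩ := wins_full (k := 3) (fun t => by
    simpa using budget_nat 3 t) hwin
  have hmem : ∀ x y : ℤ, -10 ≤ x → x ≤ 10 → -10 ≤ y → y ≤ 10 → (x, y) ∈ B 0 := by
    intro x y h1 h2 h3 h4
    rw [hB0]
    simp only [Set.mem_Icc, Prod.le_def]
    omega
  have hbd : ∀ t : ℕ, ∀ v ∈ B t, -(10 + t : ℤ) ≤ v.1 ∧ v.1 ≤ 10 + t ∧ -(10 + t : ℤ) ≤ v.2 ∧ v.2 ≤ 10 + t := by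
    intro t
    induction t with
    | zero =>
      intro v hv
      rw [hB0] at hv
      simp only [Set.mem_Icc, Prod.le_def] at hv
      push_cast
      omega
    | succ t ih =>
      intro v hv
      rw [hB t] at hv
      rcases hv with hv | ⟨-, w, hw, hwv⟩
      · have := ih v hv; push_cast; omega
      · have := ih w hw
        have := adjStrong_bd hwv
        push_cast; omega
  obtain ⟨NT, T1, T2⟩ := st_init_side (φ := phT) (fun a x y h => by simpa [phT] using h)
    (fun x => adjStrong_of (by simp [phT]) (by simp [phT])) hB hFc
    (fun x h1 h2 => hmem _ _ h1 h2 (by omega) (by omega))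
  obtain ⟨NR, R1, R2⟩ := st_init_side (φ := phR) (fun a x y h => by simpa [phR] using h)
    (fun x => adjStrong_of (by simp [phR]) (by simp [phR])) hB hFc
    (fun x h1 h2 => hmem _ _ (by omega) (by omega) h1 h2)
  obtain ⟨NB, B1, B2⟩ := st_init_side (φ := phB) (fun a x y h => by simpa [phB] using h)
    (fun x => adjStrong_of (by simp [phB]) (by simp [phB])) hB hFc
    (fun x h1 h2 => hmem _ _ h1 h2 (by omega) (by omega))
  obtain ⟨NL, L1, L2⟩ := st_init_side (φ := phL) (fun a x y h => by simpa [phL] using h)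
    (fun x => adjStrong_of (by simp [phL]) (by simp [phL])) hB hFc
    (fun x h1 h2 => hmem _ _ (by omega) (by omega) h1 h2)
  have init : St B F 0 10 10 10 10 NT NR NB NL ∅ := by
    refine ⟨by omega, by norm_num, T1, R1, B1, L1, by simp, by simp, ?_, ?_, ?_⟩
    · simp only [Finset.card_empty]; push_cast; omega
    · left; simp only [Finset.card_empty]; push_cast; omega
    · left; simp only [Finset.card_empty]; push_cast; omega
  have all : ∀ t, ∃ l r b u NT NR NB NL K, St B F t l r b u NT NR NB NL K := by
    intro t
    induction t with
    | zero => exact ⟨_, _, _, _, _, _, _, _, _, init⟩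
    | succ t ih =>
      obtain ⟨l, r, b, u, NT, NR, NB, NL, K, st⟩ := ih
      exact st_step hB hFm hFc st
  obtain ⟨l, r, b, u, NT, NR, NB, NL, K, st⟩ := all (2 * T + 21)
  have hsz := st.size
  obtain ⟨x1, h1⟩ := st.sT.ext
  obtain ⟨x2, h2⟩ := st.sR.ext
  obtain ⟨x3, h3⟩ := st.sB.ext
  obtain ⟨x4, h4⟩ := st.sL.ext
  rw [hT _ (by omega)] at h1 h2 h3 h4
  have h1 := hbd T _ h1
  have h2 := hbd T _ h2
  have h3 := hbd T _ h3
  have h4 := hbd T _ h4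
  simp only [phT, phR, phB, phL] at h1 h2 h3 h4
  push_cast at hsz
  omega

end strongSpreader


theorem qSet_ssubset_aux {V : Type*} {adj : V → V → Prop} {q : ℝ} {g : ℕ → ℕ∞} {B₀ : Set V}
    (hq : 0 < q) (hwin : ∀ B₀ : Set V, B₀.Finite → ContainerWins adj q g B₀)
    (hfin : B₀.Finite) (hno : ¬ ContainerWins adj q (fun _ => (⊤ : ℕ∞)) B₀) :
    qSet adj (fun _ => (⊤ : ℕ∞)) ⊂ qSet adj g := by
  refine ⟨?_, ?_⟩
  · rintro p ⟨hp, hw⟩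
    refine ⟨hp, fun B hB => ?_⟩
    obtain ⟨σ, hσ⟩ := hw B hB
    refine ⟨σ, fun B' h0 hl => hσ B' h0 ?_⟩
    intro t
    exact ⟨(hl t).1, le_top, (hl t).2.2⟩
  · intro h
    exact hno ((h (show q ∈ qSet adj g from ⟨hq, hwin⟩)).2 B₀ hfin)

/-- **Theorem (square-root lower bound).** For each of the graphs `Z_eighth` and
`Z_strong` and every `0 < c < 1/6`, the set of strengths for which Container wins
against the spreading function `g(t) = ⌈c·√t⌉` strictly contains the corresponding
set for unrestricted spreading. -/
theorem sqrt_spread_strictly_easier (c : ℝ) (hc0 : 0 < c) (hc : c < 1 / 6) :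
    qSet adjEighth (fun _ => (⊤ : ℕ∞)) ⊂
      qSet adjEighth (fun t => (⌈c * Real.sqrt (t : ℝ)⌉₊ : ℕ∞)) ∧
    qSet adjStrong (fun _ => (⊤ : ℕ∞)) ⊂
      qSet adjStrong (fun t => (⌈c * Real.sqrt (t : ℝ)⌉₊ : ℕ∞)) := by
  refine ⟨?_, ?_⟩
  · exact qSet_ssubset_aux (q := 1) (g := gs c) one_pos
      (fun B hB => eighth_container hc0 hc B hB) (Set.finite_singleton _) eighth_spreader
  · exact qSet_ssubset_aux (q := 3) (g := gs c) (by norm_num)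
      (fun B hB => strong_container hc0 hc B hB) (Set.finite_Icc _ _) strong_spreader
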